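/- arXiv:1111.6452 — 2 statements merged into one kernel-verified Lean document; each statement's English description precedes it below -/
import Mathlib

section
/- For a representation W of a finite quiver Q over F_q, let F_i(W) be the number of chains 0 = W_0 < W_1 < ... < W_i = W of subrepresentations with all inclusions strict (so F_0(W) = 1 if W = 0 and F_0(W) = 0 otherwise), and set F_W = Sum_{i>=0} (-1)^i F_i(W). If W is semisimple, say W is isomorphic to the direct sum over isomorphism classes of simple representations [S] of S^{m_S}, and q_S = |End_Q(S)|, then F_W = Product_{[S]} (-1)^{m_S} q_S^{m_S(m_S-1)/2}. If W is not semisimple, then F_W = 0. -/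
/- Common setup: finite quivers, finite-dimensional representations over a
finite field, subrepresentations, quotients, Hall numbers, quiver
Grassmannians and flags, extensions, and the (completed) Hall algebra,
following J. Fei, "Counting using Hall algebras I. Quivers". -/

open scoped BigOperators

attribute [local instance] Classical.propDecidable

namespace HallPaper

/-- A finite quiver: finitely many vertices and arrows. -/
structure FinQuiver where
  V : Type
  A : Type
  [fV : Fintype V]
  [fA : Fintype A]
  src : A → V
  tgt : A → V

attribute [instance] FinQuiver.fV FinQuiver.fA

/-- The additive Euler form `⟨α,β⟩_a = ∑_v α(v)β(v) - ∑_a α(ta)β(ha)`. -/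
def eulerForm (Q : FinQuiver) (α β : Q.V → ℤ) : ℤ :=
  (∑ v, α v * β v) - ∑ a, α (Q.src a) * β (Q.tgt a)

/-- The additive Euler form on dimension vectors. -/
def eulerFormN (Q : FinQuiver) (α β : Q.V → ℕ) : ℤ :=
  eulerForm Q (fun v => (α v : ℤ)) (fun v => (β v : ℤ))

/-- `Q` has no oriented cycles. -/
def NoCycles (Q : FinQuiver) : Prop :=
  ¬ ∃ (n : ℕ) (c : Fin (n + 1) → Q.A),
      (∀ i : Fin n, Q.tgt (c i.castSucc) = Q.src (c i.succ)) ∧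
      Q.tgt (c (Fin.last n)) = Q.src (c 0)

/-- A finite-dimensional representation of a finite quiver `Q` over `k`. -/
structure QRep (Q : FinQuiver) (k : Type) [Field k] where
  space : Q.V → Type
  [acg : ∀ v, AddCommGroup (space v)]
  [mod : ∀ v, Module k (space v)]
  [fd : ∀ v, FiniteDimensional k (space v)]
  map : ∀ a : Q.A, space (Q.src a) →ₗ[k] space (Q.tgt a)

attribute [instance] QRep.acg QRep.mod QRep.fd

namespace QRep

variable {Q : FinQuiver} {k : Type} [Field k]

/-- The dimension vector of a representation. -/
noncomputable def dimVec (M : QRep Q k) : Q.V → ℕ :=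
  fun v => Module.finrank k (M.space v)

/-- A morphism of quiver representations. -/
structure Hom (M N : QRep Q k) where
  app : ∀ v, M.space v →ₗ[k] N.space v
  comm : ∀ (a : Q.A) (x : M.space (Q.src a)),
    app (Q.tgt a) (M.map a x) = N.map a (app (Q.src a) x)

/-- The identity morphism. -/
def Hom.id (M : QRep Q k) : Hom M M :=
  ⟨fun _ => LinearMap.id, fun _ _ => rfl⟩

/-- Composition of morphisms. -/
def Hom.comp {M N P : QRep Q k} (g : Hom N P) (f : Hom M N) : Hom M P :=
  ⟨fun v => (g.app v).comp (f.app v), fun a x => by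
    simp only [LinearMap.comp_apply, f.comm, g.comm]⟩

/-- An isomorphism of quiver representations. -/
structure Iso (M N : QRep Q k) where
  app : ∀ v, M.space v ≃ₗ[k] N.space v
  comm : ∀ (a : Q.A) (x : M.space (Q.src a)),
    app (Q.tgt a) (M.map a x) = N.map a (app (Q.src a) x)

/-- Two representations are isomorphic. -/
def IsIsomorphic (M N : QRep Q k) : Prop := Nonempty (Iso M N)

/-- `a_M`, the number of automorphisms of `M`. -/
noncomputable def autCard (M : QRep Q k) : ℕ := Nat.card (Iso M M)

/-- `|Hom_Q(M,N)|`. -/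
noncomputable def homCard (M N : QRep Q k) : ℕ := Nat.card (Hom M N)

/-- A subrepresentation: a family of subspaces stable under all arrow maps. -/
structure SubRep (M : QRep Q k) where
  sub : ∀ v, Submodule k (M.space v)
  stable : ∀ (a : Q.A) (x : M.space (Q.src a)),
    x ∈ sub (Q.src a) → M.map a x ∈ sub (Q.tgt a)

namespace SubRep

variable {M : QRep Q k}

/-- A subrepresentation as a representation in its own right. -/
def toRep (L : SubRep M) : QRep Q k where
  space := fun v => L.sub v
  acg := fun _ => inferInstance
  mod := fun _ => inferInstance
  fd := fun _ => inferInstance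
  map := fun a => (M.map a).restrict (fun x hx => L.stable a x hx)

/-- The quotient representation `M/L`. -/
def quotRep (L : SubRep M) : QRep Q k where
  space := fun v => M.space v ⧸ L.sub v
  acg := fun _ => inferInstance
  mod := fun _ => inferInstance
  fd := fun _ => inferInstance
  map := fun a => Submodule.mapQ _ _ (M.map a) (fun x hx => L.stable a x hx)

/-- The dimension vector of a subrepresentation. -/
noncomputable def dim (L : SubRep M) : Q.V → ℕ :=
  fun v => Module.finrank k (L.sub v)

/-- The zero subrepresentation predicate. -/
def IsZero (L : SubRep M) : Prop := ∀ v, L.sub v = ⊥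

/-- The full subrepresentation predicate. -/
def IsFull (L : SubRep M) : Prop := ∀ v, L.sub v = ⊤

/-- Containment of subrepresentations. -/
def le (L L' : SubRep M) : Prop := ∀ v, L.sub v ≤ L'.sub v

/-- The subquotient `L'/L` of two nested subrepresentations. -/
def subquot (L L' : SubRep M) (h : L.le L') : QRep Q k where
  space := fun v => (L'.sub v) ⧸ ((L.sub v).comap (L'.sub v).subtype)
  acg := fun _ => inferInstance
  mod := fun _ => inferInstance
  fd := fun _ => inferInstance
  map := fun a =>
    Submodule.mapQ _ _ ((M.map a).restrict (fun x hx => L'.stable a x hx))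
      (fun x hx => by
        have hx' : (x : M.space (Q.src a)) ∈ L.sub (Q.src a) := hx
        have := L.stable a x hx'
        simpa [Submodule.mem_comap] using this)

end SubRep

/-- The number of points of the quiver Grassmannian `Gr_γ(M)`. -/
noncomputable def grCard (γ : Q.V → ℕ) (M : QRep Q k) : ℕ :=
  Nat.card {L : SubRep M // L.dim = γ}

/-- The Hall number `F_{UV}^W`: the number of subrepresentations `L ⊆ W`
with `L ≅ V` and `W/L ≅ U`. -/
noncomputable def hallNum (U V W : QRep Q k) : ℕ :=
  Nat.card {L : SubRep W // IsIsomorphic L.toRep V ∧ IsIsomorphic L.quotRep U}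

/-- The number of points of the quiver flag variety `Fl_{α_t ⋯ α_1}(M)`;
here `α i` is the dimension vector of the subquotient `L_{i+1}/L_i`. -/
noncomputable def flCard {t : ℕ} (α : Fin t → (Q.V → ℕ)) (M : QRep Q k) : ℕ :=
  Nat.card {L : Fin (t + 1) → SubRep M //
    (L 0).IsZero ∧ (L (Fin.last t)).IsFull ∧
    (∀ i : Fin t, (L i.castSucc).le (L i.succ)) ∧
    (∀ i : Fin t, ∀ v, (L i.succ).dim v = (L i.castSucc).dim v + α i v)}

/-- Cochains: the space whose quotient by coboundaries is `Ext¹_Q(U,V)`. -/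
abbrev Cochain (U V : QRep Q k) :=
  ∀ a : Q.A, U.space (Q.src a) →ₗ[k] V.space (Q.tgt a)

/-- The coboundary of a family of linear maps. -/
def coboundary {U V : QRep Q k} (f : ∀ v, U.space v →ₗ[k] V.space v) :
    Cochain U V :=
  fun a => (V.map a).comp (f (Q.src a)) - (f (Q.tgt a)).comp (U.map a)

/-- Two cochains define the same class in `Ext¹_Q(U,V)`. -/
def extRel (U V : QRep Q k) (z z' : Cochain U V) : Prop :=
  ∃ f, z' = z + coboundary f

/-- `|Ext¹_Q(U,V)|`. -/
noncomputable def ext1Card (U V : QRep Q k) : ℕ := Nat.card (Quot (extRel U V))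

/-- The middle term of the extension of `U` by `V` defined by a cochain. -/
def middle {U V : QRep Q k} (z : Cochain U V) : QRep Q k where
  space := fun v => V.space v × U.space v
  acg := fun _ => inferInstance
  mod := fun _ => inferInstance
  fd := fun _ => inferInstance
  map := fun a =>
    LinearMap.prod
      ((V.map a).comp (LinearMap.fst k _ _) + (z a).comp (LinearMap.snd k _ _))
      ((U.map a).comp (LinearMap.snd k _ _))

/-- `|Ext_Q(U,V)_W|`: the number of classes in `Ext¹_Q(U,V)` of extensions
with middle term isomorphic to `W`. -/
noncomputable def extWCard (U V W : QRep Q k) : ℕ :=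
  Nat.card {e : Quot (extRel U V) //
    ∃ z : Cochain U V, Quot.mk _ z = e ∧ IsIsomorphic (middle z) W}

/-- `T` is rigid, i.e. `Ext¹_Q(T,T) = 0`. -/
def IsRigid (T : QRep Q k) : Prop :=
  ∀ z : Cochain T T, ∃ f, z = coboundary f

/-- Direct sum of two representations. -/
def dsum (M N : QRep Q k) : QRep Q k where
  space := fun v => M.space v × N.space v
  acg := fun _ => inferInstance
  mod := fun _ => inferInstance
  fd := fun _ => inferInstance
  map := fun a => (M.map a).prodMap (N.map a)

/-- Finite direct sums of representations. -/
def dsumFin {ι : Type} [Fintype ι] (f : ι → QRep Q k) : QRep Q k where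
  space := fun v => ∀ i, (f i).space v
  acg := fun _ => inferInstance
  mod := fun _ => inferInstance
  fd := fun _ => inferInstance
  map := fun a => LinearMap.pi (fun i => ((f i).map a).comp (LinearMap.proj i))

/-- A simple representation. -/
def IsSimple (M : QRep Q k) : Prop :=
  M.dimVec ≠ 0 ∧ ∀ L : SubRep M, L.IsZero ∨ L.IsFull

/-- An indecomposable representation. -/
def Indecomposable (M : QRep Q k) : Prop :=
  M.dimVec ≠ 0 ∧
    ∀ A B : QRep Q k, IsIsomorphic M (dsum A B) → A.dimVec = 0 ∨ B.dimVec = 0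

end QRep

open QRep

/-- The affine space of `α`-dimensional representations: one matrix per arrow. -/
def StdRep (Q : FinQuiver) (k : Type) [Field k] (α : Q.V → ℕ) :=
  ∀ a : Q.A, Matrix (Fin (α (Q.tgt a))) (Fin (α (Q.src a))) k

instance (Q : FinQuiver) (k : Type) [Field k] [Fintype k] (α : Q.V → ℕ) :
    Finite (StdRep Q k α) := by
  unfold StdRep; infer_instance

/-- A point of `Rep_α(Q)` as an abstract representation. -/
def StdRep.toQRep {Q : FinQuiver} {k : Type} [Field k] {α : Q.V → ℕ}
    (W : StdRep Q k α) : QRep Q k where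
  space := fun v => Fin (α v) → k
  acg := fun _ => inferInstance
  mod := fun _ => inferInstance
  fd := fun _ => inferInstance
  map := fun a => Matrix.mulVecLin (W a)

/-- Isomorphism relation on `α`-dimensional representations. -/
def isoRel (Q : FinQuiver) (k : Type) [Field k] (α : Q.V → ℕ)
    (W W' : StdRep Q k α) : Prop :=
  IsIsomorphic W.toQRep W'.toQRep

/-- Isomorphism classes of `α`-dimensional representations of `Q` over `k`. -/
def IsoClass (Q : FinQuiver) (k : Type) [Field k] (α : Q.V → ℕ) :=
  Quot (isoRel Q k α)

/-- A representative representation of an isomorphism class. -/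
noncomputable def IsoClass.rep {Q : FinQuiver} {k : Type} [Field k]
    {α : Q.V → ℕ} (c : IsoClass Q k α) : QRep Q k :=
  (Quot.out c).toQRep

/-- Isomorphism classes of representations of all dimension vectors. -/
abbrev TotalClass (Q : FinQuiver) (k : Type) [Field k] :=
  Σ α : Q.V → ℕ, IsoClass Q k α

/-- A representative of a class in `TotalClass`. -/
noncomputable def TotalClass.rep {Q : FinQuiver} {k : Type} [Field k]
    (c : TotalClass Q k) : QRep Q k :=
  c.2.rep

section Counting

variable (Q : FinQuiver) (k : Type) [Field k] [Fintype k]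

/-- `|Rep_α(Q)(F_q)|`. -/
noncomputable def repCard (α : Q.V → ℕ) : ℕ := Nat.card (StdRep Q k α)

/-- `|GL_α(F_q)|`. -/
noncomputable def glCard (α : Q.V → ℕ) : ℕ :=
  Nat.card (∀ v : Q.V, Matrix.GeneralLinearGroup (Fin (α v)) k)

/-- `r_α(q) = |Rep_α(Q)| / |GL_α|`. -/
noncomputable def rFun (α : Q.V → ℕ) : ℚ :=
  (repCard Q k α : ℚ) / (glCard Q k α : ℚ)

end Counting

section Slope

variable {Q : FinQuiver}

/-- The value of a weight (`ℤ`-linear functional) on a dimension vector. -/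
def wt (σ : Q.V → ℤ) (α : Q.V → ℕ) : ℤ := ∑ v, σ v * α v

/-- The slope `μ(α) = σ(α)/θ(α)`. -/
noncomputable def slope (σ θ : Q.V → ℤ) (α : Q.V → ℕ) : ℚ :=
  (wt σ α : ℚ) / (wt θ α : ℚ)

/-- `θ` is positive on all nonzero dimension vectors (so `σ/θ` is a slope
function). -/
def SlopeOK (θ : Q.V → ℤ) : Prop :=
  ∀ α : Q.V → ℕ, α ≠ 0 → 0 < wt θ α

variable {k : Type} [Field k]

/-- `μ`-semistability. -/
def IsSemistable (σ θ : Q.V → ℤ) (M : QRep Q k) : Prop :=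
  ∀ L : SubRep M, ¬ L.IsZero → ¬ L.IsFull →
    slope σ θ L.dim ≤ slope σ θ M.dimVec

/-- `μ`-stability. -/
def IsStable (σ θ : Q.V → ℤ) (M : QRep Q k) : Prop :=
  ∀ L : SubRep M, ¬ L.IsZero → ¬ L.IsFull →
    slope σ θ L.dim < slope σ θ M.dimVec

/-- `μ` is coprime to `α`: `μ(γ) ≠ μ(α)` for all `0 < γ < α`. -/
def Coprime (σ θ : Q.V → ℤ) (α : Q.V → ℕ) : Prop :=
  ∀ γ : Q.V → ℕ, γ ≠ 0 → γ ≤ α → γ ≠ α → slope σ θ γ ≠ slope σ θ α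

end Slope

section Decomp

variable {Q : FinQuiver}

/-- Ordered decompositions `α = α_1 + ⋯ + α_s` into nonzero dimension vectors
with strictly increasing slopes (Harder–Narasimhan type). -/
structure HNDecomp (σ θ : Q.V → ℤ) (α : Q.V → ℕ) where
  s : ℕ
  pos : 0 < s
  d : Fin s → (Q.V → ℕ)
  nonzero : ∀ i, d i ≠ 0
  total : ∑ i, d i = α
  incr : ∀ i j : Fin s, i < j → slope σ θ (d i) < slope σ θ (d j)

/-- Ordered decompositions `α = α_1 + ⋯ + α_s` into nonzero dimension vectors
with `μ(α_1 + ⋯ + α_k) < μ(α)` for all `k < s`. -/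
structure StarDecomp (σ θ : Q.V → ℤ) (α : Q.V → ℕ) where
  s : ℕ
  pos : 0 < s
  d : Fin s → (Q.V → ℕ)
  nonzero : ∀ i, d i ≠ 0
  total : ∑ i, d i = α
  partial_lt : ∀ kk : Fin s, (kk : ℕ) + 1 < s →
    slope σ θ (∑ i ∈ Finset.Iic kk, d i) < slope σ θ α

end Decomp

section Hall

variable (Q : FinQuiver) (k : Type) [Field k]

/-- The underlying space of the completed Hall algebra: formal (possibly
infinite) linear combinations of isomorphism classes. -/
abbrev HallAlg := TotalClass Q k → ℚ

/-- The Hall product `[U][V] = ∑_{[W]} F_{UV}^W [W]`, written on coefficient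
functions. -/
noncomputable def hallMul (x y : HallAlg Q k) : HallAlg Q k :=
  fun W => ∑ᶠ (U : TotalClass Q k) (V : TotalClass Q k),
    x U * y V * (hallNum U.rep V.rep W.rep : ℚ)

/-- The unit `[0]` of the Hall algebra. -/
noncomputable def hallOne : HallAlg Q k :=
  fun c => if c.1 = 0 then 1 else 0

/-- Iterated Hall product of a list. -/
noncomputable def hallProd (l : List (HallAlg Q k)) : HallAlg Q k :=
  l.foldr (hallMul Q k) (hallOne Q k)

/-- The twisted Hall product `[U][V] = ∑_{[W]} q^{⟨dim U, dim V⟩} F_{UV}^W [W]`. -/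
noncomputable def hallMulTw [Fintype k] (x y : HallAlg Q k) : HallAlg Q k :=
  fun W => ∑ᶠ (U : TotalClass Q k) (V : TotalClass Q k),
    x U * y V * ((Fintype.card k : ℚ) ^ eulerFormN Q U.rep.dimVec V.rep.dimVec) *
      (hallNum U.rep V.rep W.rep : ℚ)

/-- `χ_α`, the sum of all `[M]` with `dim M = α`. -/
noncomputable def chiElt (α : Q.V → ℕ) : HallAlg Q k :=
  fun c => if c.1 = α then 1 else 0

/-- `χ_α^{ss}`, the sum of all semistable `[M]` with `dim M = α`. -/
noncomputable def chiSS (σ θ : Q.V → ℤ) (α : Q.V → ℕ) : HallAlg Q k :=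
  fun c => if c.1 = α ∧ IsSemistable σ θ c.rep then 1 else 0

/-- The completed quantum polynomial algebra `P_{⟨Q⟩}` (coefficient functions
on monomials `t^α`). -/
abbrev QPoly := (Q.V → ℕ) → ℚ

/-- Multiplication `t^α t^β = q^{-⟨α,β⟩_a} t^{α+β}` of `P_{⟨Q⟩}`. -/
noncomputable def qpolyMul [Fintype k] (x y : QPoly Q) : QPoly Q :=
  fun α => ∑ᶠ (β : Q.V → ℕ) (γ : Q.V → ℕ),
    if β + γ = α then
      ((Fintype.card k : ℚ) ^ (-(eulerFormN Q β γ))) * x β * y γ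
    else 0

/-- The unit of `P_{⟨Q⟩}`. -/
noncomputable def qpolyOne : QPoly Q :=
  fun α => if α = 0 then 1 else 0

/-- The integration map `∫ : H(Q) → P_{⟨Q⟩}`, `[M] ↦ a_M⁻¹ t^{dim M}`. -/
noncomputable def intChar (x : HallAlg Q k) : QPoly Q :=
  fun α => ∑ᶠ c : IsoClass Q k α, x ⟨α, c⟩ / (autCard (IsoClass.rep c) : ℚ)

end Hall

section Chains

variable {Q : FinQuiver} {k : Type} [Field k]

/-- The number of strict chains `0 = W_0 < W_1 < ⋯ < W_i = W` of
subrepresentations. -/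
noncomputable def chainCount (M : QRep Q k) (i : ℕ) : ℕ :=
  Nat.card {L : Fin (i + 1) → SubRep M //
    (L 0).IsZero ∧ (L (Fin.last i)).IsFull ∧
    ∀ j : Fin i, (L j.castSucc).le (L j.succ) ∧
      (L j.castSucc).sub ≠ (L j.succ).sub}

/-- `F_W = ∑_i (-1)^i F_i(W)`, the alternating sum of numbers of strict
chains of subrepresentations. -/
noncomputable def FW (M : QRep Q k) : ℚ :=
  ∑ᶠ i : ℕ, (-1 : ℚ) ^ i * (chainCount M i : ℚ)

end Chains

section Moebius

variable {P : Type} [PartialOrder P] [OrderBot P] [Finite P]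

/-- Number of strict chains of length `i` from `⊥` to `a`. -/
noncomputable def chN (a : P) (i : ℕ) : ℕ :=
  Nat.card {L : Fin (i + 1) → P //
    L 0 = ⊥ ∧ L (Fin.last i) = a ∧ ∀ j : Fin i, L j.castSucc < L j.succ}

/-- Alternating sum of numbers of strict chains from `⊥` to `a`. -/
noncomputable def muN (a : P) : ℚ := ∑ᶠ i : ℕ, (-1 : ℚ) ^ i * (chN a i : ℚ)

lemma chN_eq_zero (a : P) (i : ℕ) (h : Nat.card P ≤ i) : chN a i = 0 := by
  unfold chN
  rw [Nat.card_eq_zero]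
  left
  constructor
  rintro ⟨L, -, -, h3⟩
  have hm : StrictMono L := Fin.strictMono_iff_lt_succ.2 h3
  have := Nat.card_le_card_of_injective L hm.injective
  simp at this
  omega

lemma muN_eq_sum (a : P) (N : ℕ) (h : Nat.card P ≤ N) :
    muN a = ∑ i ∈ Finset.range N, (-1 : ℚ) ^ i * (chN a i : ℚ) := by
  unfold muN
  apply finsum_eq_sum_of_support_subset
  intro i hi
  simp only [Function.mem_support] at hi
  simp only [Finset.coe_range, Set.mem_Iio]
  by_contra hc
  apply hi
  rw [chN_eq_zero a i (by omega)]
  simp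

lemma chN_zero (a : P) : chN a 0 = if a = ⊥ then 1 else 0 := by
  unfold chN
  split_ifs with h
  · subst h
    rw [Nat.card_eq_one_iff_unique]
    refine ⟨⟨?_⟩, ⟨⟨fun _ => ⊥, rfl, rfl, fun j => j.elim0⟩⟩⟩
    rintro ⟨L, h1, -⟩ ⟨L', h1', -⟩
    ext j
    have : j = 0 := by apply Fin.ext; have := j.2; simp only [Fin.val_zero]; omega
    subst this
    simp [h1, h1']
  · rw [Nat.card_eq_zero]
    left
    constructor
    rintro ⟨L, h1, h2, -⟩
    exact h (h2.symm.trans h1)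

lemma chN_succ [Fintype P] (a : P) (i : ℕ) :
    chN a (i + 1) = ∑ b : {b : P // b < a}, chN b.1 i := by
  unfold chN
  rw [← Nat.card_sigma]
  have key : ∀ x y : (Σ b : {b : P // b < a}, {L : Fin (i + 1) → P //
      L 0 = ⊥ ∧ L (Fin.last i) = b.1 ∧ ∀ j : Fin i, L j.castSucc < L j.succ}),
      x.1.1 = y.1.1 → x.2.1 = y.2.1 → x = y := by
    rintro ⟨⟨b, hb⟩, ⟨L, hL⟩⟩ ⟨⟨b', hb'⟩, ⟨L', hL'⟩⟩ h h'
    obtain rfl : b = b' := h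
    obtain rfl : L = L' := h'
    rfl
  refine Nat.card_congr ⟨fun L => ⟨⟨L.1 (Fin.last i).castSucc, ?_⟩,
    ⟨fun j => L.1 j.castSucc, ?_, rfl, fun j => ?_⟩⟩,
    fun x => ⟨Fin.snoc (α := fun _ => P) x.2.1 a, ?_, ?_, ?_⟩, ?_, ?_⟩
  · have := L.2.2.2 (Fin.last i)
    rw [Fin.succ_last, L.2.2.1] at this
    exact this
  · exact L.2.1
  · exact L.2.2.2 j.castSucc
  · have : (0 : Fin (i + 2)) = Fin.castSucc 0 := rfl
    rw [this, Fin.snoc_castSucc]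
    exact x.2.2.1
  · simp
  · intro j
    refine Fin.lastCases ?_ (fun j => ?_) j
    · rw [Fin.succ_last, Fin.snoc_last, Fin.snoc_castSucc, x.2.2.2.1]
      exact x.1.2
    · rw [Fin.succ_castSucc, Fin.snoc_castSucc, Fin.snoc_castSucc]
      exact x.2.2.2.2 j
  · rintro ⟨L, h1, h2, h3⟩
    ext j
    refine Fin.lastCases ?_ (fun j => ?_) j
    · simp [h2]
    · simp
  · rintro ⟨⟨b, hb⟩, ⟨L, hL⟩⟩
    apply key
    · simp only [Fin.snoc_castSucc]
      exact hL.2.1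
    · simp only [Fin.snoc_castSucc]

lemma muN_rec [Fintype P] (a : P) :
    muN a = (if a = ⊥ then 1 else 0) - ∑ b : {b : P // b < a}, muN b.1 := by
  rw [muN_eq_sum a (Nat.card P + 1) (by omega), Finset.sum_range_succ', chN_zero]
  have : ∀ b : P, muN b = ∑ i ∈ Finset.range (Nat.card P), (-1 : ℚ) ^ i * (chN b i : ℚ) :=
    fun b => muN_eq_sum b _ le_rfl
  simp only [this]
  rw [Finset.sum_comm]
  have h2 : ∀ i, (-1 : ℚ) ^ (i + 1) * (chN a (i + 1) : ℚ)
      = - ∑ b : {b : P // b < a}, (-1 : ℚ) ^ i * (chN b.1 i : ℚ) := by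
    intro i
    rw [chN_succ, ← Finset.mul_sum]
    push_cast
    ring
  simp only [h2, Finset.sum_neg_distrib]
  push_cast
  split_ifs <;> ring

lemma muN_bot : muN (⊥ : P) = 1 := by
  have := Fintype.ofFinite P
  rw [muN_rec]
  have : IsEmpty {b : P // b < ⊥} := ⟨fun b => not_lt_bot b.2⟩
  simp

lemma sum_le_muN [Fintype P] (a : P) (ha : a ≠ ⊥) :
    ∑ b ∈ Finset.univ.filter (fun b : P => b ≤ a), muN b = 0 := by
  have h1 : Finset.univ.filter (fun b : P => b ≤ a)
      = insert a (Finset.univ.filter (fun b : P => b < a)) := by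
    ext b
    simp [le_iff_eq_or_lt]
  rw [h1, Finset.sum_insert (by simp), muN_rec a, if_neg ha,
    ← Finset.sum_subtype_eq_sum_filter, Finset.subtype_univ]
  simp

/-- Invariance of `muN` under embeddings onto lower sets. -/
lemma muN_map {P' : Type} [PartialOrder P'] [OrderBot P'] [Finite P']
    (e : P ↪o P') (hbot : e ⊥ = ⊥) (hlow : ∀ a b, b ≤ e a → ∃ c, e c = b) (a : P) :
    muN (e a) = muN a := by
  have := Fintype.ofFinite P
  have := Fintype.ofFinite P'
  induction a using WellFoundedLT.induction with
  | ind a ih =>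
  rw [muN_rec, muN_rec a]
  congr 1
  · rw [← hbot]; simp
  · symm
    refine Fintype.sum_bijective (fun b : {b : P // b < a} =>
      (⟨e b.1, e.lt_iff_lt.2 b.2⟩ : {b : P' // b < e a})) ⟨?_, ?_⟩ _ _ ?_
    · intro b c h
      simpa [Subtype.ext_iff] using h
    · rintro ⟨b, hb⟩
      obtain ⟨c, rfl⟩ := hlow a b hb.le
      exact ⟨⟨c, e.lt_iff_lt.1 hb⟩, rfl⟩
    · intro b
      exact (ih b.1 b.2).symm

end Moebius

section Weisner

variable {P : Type} [Lattice P] [BoundedOrder P] [Fintype P]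

lemma weisner (a : P) (ha : a ≠ ⊥) (y : P) (hy : a ≤ y) :
    ∑ x ∈ Finset.univ.filter (fun x : P => x ⊔ a = y), muN x = 0 := by
  induction y using WellFoundedLT.induction with
  | ind y ih =>
  have hyb : y ≠ ⊥ := fun h => ha (le_bot_iff.1 (h ▸ hy))
  have h1 := sum_le_muN y hyb
  rw [← Finset.sum_fiberwise_of_maps_to
    (t := Finset.univ.filter (fun z : P => a ≤ z ∧ z ≤ y)) (g := fun x => x ⊔ a)] at h1
  · rw [Finset.sum_eq_single y] at h1
    · rw [← h1]
      apply Finset.sum_congr _ (fun _ _ => rfl)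
      ext x
      simp only [Finset.mem_filter, Finset.mem_univ, true_and]
      exact ⟨fun h => ⟨h ▸ le_sup_left, h⟩, fun h => h.2⟩
    · intro z hz hzy
      simp only [Finset.mem_filter, Finset.mem_univ, true_and] at hz
      rw [← ih z (lt_of_le_of_ne hz.2 hzy) hz.1]
      apply Finset.sum_congr _ (fun _ _ => rfl)
      ext x
      simp only [Finset.mem_filter, Finset.mem_univ, true_and]
      exact ⟨fun h => h.2, fun h => ⟨(h ▸ le_sup_left : x ≤ z).trans hz.2, h⟩⟩
    · intro h
      simp [hy] at h
  · intro x hx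
    simp only [Finset.mem_filter, Finset.mem_univ, true_and] at hx ⊢
    exact ⟨le_sup_right, sup_le hx hy⟩

lemma muN_top_atom (a : P) (ha : IsAtom a) :
    muN (⊤ : P) = - ∑ x : {x : P // IsCompl x a}, muN x.1 := by
  have h := weisner a ha.1 ⊤ le_top
  have h1 : Finset.univ.filter (fun x : P => x ⊔ a = ⊤)
      = insert ⊤ (Finset.univ.filter (fun x : P => IsCompl x a)) := by
    ext x
    simp only [Finset.mem_filter, Finset.mem_univ, true_and, Finset.mem_insert]
    constructor
    · intro hx
      rcases ha.le_iff.1 (inf_le_right : x ⊓ a ≤ a) with h0 | h0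
      · exact Or.inr ⟨disjoint_iff.2 h0, codisjoint_iff.2 hx⟩
      · left
        rw [← hx]
        exact (sup_eq_left.2 (inf_eq_right.1 h0)).symm
    · rintro (rfl | hx)
      · simp
      · exact hx.sup_eq_top
  rw [h1, Finset.sum_insert, ← Finset.sum_subtype_eq_sum_filter, Finset.subtype_univ] at h
  · linarith
  · simp only [Finset.mem_filter, Finset.mem_univ, true_and]
    intro hc
    exact ha.1 (by simpa using hc.inf_eq_bot)

end Weisner

namespace QRep

variable {Q : FinQuiver} {k : Type} [Field k]

lemma SubRep.ext' {M : QRep Q k} {L L' : SubRep M} (h : L.sub = L'.sub) : L = L' := by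
  cases L; cases L'; cases h; rfl

instance (M : QRep Q k) : PartialOrder (SubRep M) :=
  PartialOrder.lift SubRep.sub (fun _ _ h => SubRep.ext' h)

lemma SubRep.le_def {M : QRep Q k} {L L' : SubRep M} : L ≤ L' ↔ ∀ v, L.sub v ≤ L'.sub v :=
  Iff.rfl

instance (M : QRep Q k) : Lattice (SubRep M) :=
  { (inferInstance : PartialOrder (SubRep M)) with
    sup := fun L L' => ⟨fun v => L.sub v ⊔ L'.sub v, by
      intro a x hx
      obtain ⟨y, hy, z, hz, rfl⟩ := Submodule.mem_sup.1 hx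
      rw [map_add]
      exact Submodule.add_mem_sup (L.stable a y hy) (L'.stable a z hz)⟩
    inf := fun L L' => ⟨fun v => L.sub v ⊓ L'.sub v, fun a x hx =>
      ⟨L.stable a x hx.1, L'.stable a x hx.2⟩⟩
    le_sup_left := fun _ _ _ => le_sup_left
    le_sup_right := fun _ _ _ => le_sup_right
    sup_le := fun _ _ _ h h' v => sup_le (h v) (h' v)
    inf_le_left := fun _ _ _ => inf_le_left
    inf_le_right := fun _ _ _ => inf_le_right
    le_inf := fun _ _ _ h h' v => le_inf (h v) (h' v) }

instance (M : QRep Q k) : BoundedOrder (SubRep M) where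
  top := ⟨fun _ => ⊤, fun _ _ _ => trivial⟩
  le_top := fun _ _ => le_top
  bot := ⟨fun _ => ⊥, fun a x hx => by
    rw [Submodule.mem_bot] at hx ⊢
    rw [hx, map_zero]⟩
  bot_le := fun _ _ => bot_le

lemma SubRep.isZero_iff {M : QRep Q k} {L : SubRep M} : L.IsZero ↔ L = ⊥ :=
  ⟨fun h => SubRep.ext' (funext h), fun h => by subst h; exact fun _ => rfl⟩

lemma SubRep.isFull_iff {M : QRep Q k} {L : SubRep M} : L.IsFull ↔ L = ⊤ :=
  ⟨fun h => SubRep.ext' (funext h), fun h => by subst h; exact fun _ => rfl⟩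

instance [Fintype k] (M : QRep Q k) : Finite (SubRep M) := by
  have : ∀ v, Finite (M.space v) := fun v => Module.finite_of_finite k
  have : ∀ v, Finite (Submodule k (M.space v)) := fun v =>
    Finite.of_injective (fun p : Submodule k (M.space v) => (p : Set (M.space v)))
      SetLike.coe_injective
  exact Finite.of_injective SubRep.sub (fun _ _ h => SubRep.ext' h)

lemma FW_eq_muN [Fintype k] (M : QRep Q k) : FW M = muN (⊤ : SubRep M) := by
  unfold FW muN
  congr 1
  ext i
  congr 2
  unfold chainCount chN
  refine Nat.card_congr (Equiv.subtypeEquivRight fun L => ?_)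
  rw [SubRep.isZero_iff, SubRep.isFull_iff]
  refine and_congr_right fun _ => and_congr_right fun _ => forall_congr' fun j => ?_
  rw [lt_iff_le_and_ne]
  exact and_congr Iff.rfl (not_congr ⟨fun h => SubRep.ext' h, fun h => by rw [h]⟩)

/-- Injectivity of a morphism. -/
def Hom.Inj {M N : QRep Q k} (f : Hom M N) : Prop := ∀ v, Function.Injective (f.app v)

/-- Image of a subrepresentation. -/
def SubRep.image {M N : QRep Q k} (f : Hom M N) (L : SubRep M) : SubRep N :=
  ⟨fun v => (L.sub v).map (f.app v), by
    rintro a _ ⟨y, hy, rfl⟩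
    exact ⟨M.map a y, L.stable a y hy, f.comm a y⟩⟩

/-- Preimage of a subrepresentation. -/
def SubRep.preim {M N : QRep Q k} (f : Hom M N) (L : SubRep N) : SubRep M :=
  ⟨fun v => (L.sub v).comap (f.app v), by
    intro a x hx
    rw [Submodule.mem_comap] at hx ⊢
    rw [f.comm]
    exact L.stable a _ hx⟩

/-- Order embedding of subrepresentations induced by an injective morphism. -/
def imageEmb {M N : QRep Q k} (f : Hom M N) (hf : f.Inj) : SubRep M ↪o SubRep N :=
  OrderEmbedding.ofMapLEIff (SubRep.image f) (fun L L' =>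
    forall_congr' fun v => Submodule.map_le_map_iff_of_injective (hf v) _ _)

lemma image_bot {M N : QRep Q k} (f : Hom M N) : SubRep.image f ⊥ = ⊥ :=
  SubRep.ext' (funext fun v => Submodule.map_bot (f.app v))

lemma image_preim {M N : QRep Q k} (f : Hom M N) (L : SubRep N)
    (h : L ≤ SubRep.image f ⊤) : SubRep.image f (SubRep.preim f L) = L := by
  apply SubRep.ext'
  funext v
  refine Submodule.map_comap_eq_self ?_
  have := h v
  rwa [show (SubRep.image f ⊤).sub v = (⊤ : Submodule k _).map (f.app v) from rfl,
    Submodule.map_top] at this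

lemma FW_eq_of_inj [Fintype k] {M N : QRep Q k} (f : Hom M N) (hf : f.Inj) :
    FW M = muN (SubRep.image f ⊤) := by
  rw [FW_eq_muN]
  refine (muN_map (imageEmb f hf) (image_bot f) ?_ ⊤).symm
  intro a b hb
  exact ⟨SubRep.preim f b, image_preim f b (hb.trans ((imageEmb f hf).monotone le_top))⟩

/-- The morphism underlying an isomorphism. -/
def Iso.toHom {M N : QRep Q k} (e : Iso M N) : Hom M N :=
  ⟨fun v => (e.app v).toLinearMap, e.comm⟩

lemma FW_iso [Fintype k] {M N : QRep Q k} (h : IsIsomorphic M N) : FW M = FW N := by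
  obtain ⟨e⟩ := h
  rw [FW_eq_of_inj e.toHom (fun v => (e.app v).injective), FW_eq_muN]
  congr 1
  apply SubRep.ext'
  funext v
  change Submodule.map (e.app v).toLinearMap ⊤ = ⊤
  rw [Submodule.map_top, LinearEquiv.range]

/-- Inverse isomorphism. -/
def Iso.symm' {M N : QRep Q k} (e : Iso M N) : Iso N M :=
  ⟨fun v => (e.app v).symm, fun a x => by
    rw [LinearEquiv.symm_apply_eq, e.comm, LinearEquiv.apply_symm_apply]⟩

/-- Composition of isomorphisms. -/
def Iso.trans' {M N P : QRep Q k} (e : Iso M N) (f : Iso N P) : Iso M P :=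
  ⟨fun v => (e.app v).trans (f.app v), fun a x => by
    simp only [LinearEquiv.trans_apply, e.comm, f.comm]⟩

/-- First inclusion. -/
def inlHom (A X : QRep Q k) : Hom A (dsum A X) :=
  ⟨fun v => LinearMap.inl k (A.space v) (X.space v), fun a x => by
    change (A.map a x, 0) = (A.map a x, X.map a 0)
    rw [map_zero]⟩

/-- Graph embedding. -/
def graphHom {A X : QRep Q k} (h : Hom X A) : Hom X (dsum A X) :=
  ⟨fun v => LinearMap.prod (h.app v) LinearMap.id, fun a x => by
    change (h.app _ (X.map a x), X.map a x) = (A.map a (h.app _ x), X.map a x)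
    rw [h.comm]⟩

lemma Hom.ext' {M N : QRep Q k} {f g : Hom M N} (h : f.app = g.app) : f = g := by
  cases f; cases g; cases h; rfl

lemma top_ne_bot_of_simple {A : QRep Q k} (hA : IsSimple A) : (⊤ : SubRep A) ≠ ⊥ := by
  intro h
  apply hA.1
  funext v
  have h2 : (⊤ : Submodule k (A.space v)) = ⊥ := congrFun (congrArg SubRep.sub h) v
  change Module.finrank k (A.space v) = 0
  rw [← finrank_top k (A.space v), h2, finrank_bot]

lemma simple_iff {A : QRep Q k} : IsSimple A ↔ IsAtom (⊤ : SubRep A) := by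
  constructor
  · intro hA
    refine ⟨top_ne_bot_of_simple hA, fun L hL => ?_⟩
    rcases hA.2 L with h | h
    · exact SubRep.isZero_iff.1 h
    · exact absurd (SubRep.isFull_iff.1 h) hL.ne
  · intro h
    refine ⟨fun h0 => h.1 ?_, fun L => ?_⟩
    · apply SubRep.ext'
      funext v
      have : Module.finrank k (A.space v) = 0 := congrFun h0 v
      have := Module.finrank_zero_iff.1 this
      exact Subsingleton.elim _ _
    · rw [SubRep.isZero_iff, SubRep.isFull_iff]
      exact h.le_iff.1 le_top

lemma image_top_atom {A M : QRep Q k} (f : Hom A M) (hf : f.Inj) :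
    IsAtom (SubRep.image f ⊤) ↔ IsAtom (⊤ : SubRep A) := by
  constructor
  · intro h
    refine ⟨fun h0 => h.1 (by rw [h0, image_bot]), fun L hL => ?_⟩
    have := h.2 _ ((imageEmb f hf).strictMono hL)
    exact (imageEmb f hf).injective (this.trans (image_bot f).symm)
  · intro h
    refine ⟨fun h0 => h.1 ((imageEmb f hf).injective (h0.trans (image_bot f).symm)),
      fun L hL => ?_⟩
    have h1 := image_preim f L hL.le
    rcases h.le_iff.1 (le_top : SubRep.preim f L ≤ ⊤) with h2 | h2
    · rw [← h1, h2, image_bot]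
    · rw [h2] at h1
      exact absurd h1.symm hL.ne

lemma compl_iff {M : QRep Q k} {L L' : SubRep M} :
    IsCompl L L' ↔ ∀ v, IsCompl (L.sub v) (L'.sub v) := by
  constructor
  · intro h v
    exact ⟨disjoint_iff.2 (congrFun (congrArg SubRep.sub h.inf_eq_bot) v),
      codisjoint_iff.2 (congrFun (congrArg SubRep.sub h.sup_eq_top) v)⟩
  · intro h
    exact ⟨disjoint_iff.2 (SubRep.ext' (funext fun v => (h v).inf_eq_bot)),
      codisjoint_iff.2 (SubRep.ext' (funext fun v => (h v).sup_eq_top))⟩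

lemma mem_graph {A X : QRep Q k} (h : Hom X A) (v : Q.V) (p : A.space v × X.space v) :
    p ∈ (SubRep.image (graphHom h) ⊤).sub v ↔ h.app v p.2 = p.1 := by
  constructor
  · rintro ⟨y, -, rfl⟩
    rfl
  · intro hp
    exact ⟨p.2, trivial, Prod.ext hp rfl⟩

lemma mem_inl {A X : QRep Q k} (v : Q.V) (p : A.space v × X.space v) :
    p ∈ (SubRep.image (inlHom A X) ⊤).sub v ↔ p.2 = 0 := by
  constructor
  · rintro ⟨y, -, rfl⟩
    rfl
  · intro hp
    exact ⟨p.1, trivial, Prod.ext rfl hp.symm⟩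

lemma graph_compl {A X : QRep Q k} (h : Hom X A) :
    IsCompl (SubRep.image (graphHom h) ⊤) (SubRep.image (inlHom A X) ⊤) := by
  rw [compl_iff]
  intro v
  constructor
  · rw [Submodule.disjoint_def]
    intro p h1 h2
    have h1' := (mem_graph h v p).1 h1
    have h2' := (mem_inl v p).1 h2
    rw [h2', map_zero] at h1'
    exact Prod.ext h1'.symm h2'
  · rw [codisjoint_iff, eq_top_iff]
    intro p _
    have hp : p = (graphHom h).app v (Prod.snd p) +
        (show (dsum A X).space v from (Prod.fst p - h.app v (Prod.snd p), 0)) := by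
      apply Prod.ext
      · change p.1 = h.app v p.2 + (p.1 - h.app v p.2)
        abel
      · change p.2 = p.2 + 0
        rw [add_zero]
    rw [hp]
    exact Submodule.add_mem_sup ⟨_, trivial, rfl⟩ ((mem_inl v _).2 rfl)

lemma exists_graph {A X : QRep Q k} (L : SubRep (dsum A X))
    (hL : IsCompl L (SubRep.image (inlHom A X) ⊤)) :
    ∃ h : Hom X A, SubRep.image (graphHom h) ⊤ = L := by
  rw [compl_iff] at hL
  have huniq : ∀ v (p q : A.space v × X.space v), p ∈ L.sub v → q ∈ L.sub v →
      p.2 = q.2 → p = q := by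
    intro v p q hp hq hpq
    have h1 : p - q ∈ L.sub v := Submodule.sub_mem _ hp hq
    have h2 : p - q ∈ (SubRep.image (inlHom A X) ⊤).sub v :=
      (mem_inl v _).2 (by rw [Prod.snd_sub, hpq, sub_self])
    exact sub_eq_zero.1 ((Submodule.disjoint_def.1 (hL v).1) _ h1 h2)
  have hex : ∀ v (x : X.space v), ∃ a : A.space v, ((a, x) : A.space v × X.space v) ∈ L.sub v := by
    intro v x
    have : (show (dsum A X).space v from (0, x)) ∈
        L.sub v ⊔ (SubRep.image (inlHom A X) ⊤).sub v := by
      rw [(hL v).sup_eq_top]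
      trivial
    obtain ⟨p, hp, q, hq, hpq⟩ := Submodule.mem_sup.1 this
    have hq' := (mem_inl v q).1 hq
    refine ⟨Prod.fst p, ?_⟩
    have h2 : Prod.snd p = x := by
      have h3 : Prod.snd p + Prod.snd q = x := congrArg Prod.snd hpq
      rwa [hq', add_zero] at h3
    rw [← h2]
    exact hp
  choose g hg using hex
  have key : ∀ v (p : A.space v × X.space v), p ∈ L.sub v → g v p.2 = p.1 := fun v p hp =>
    congrArg Prod.fst (huniq v (g v p.2, p.2) p (hg v _) hp rfl)
  refine ⟨⟨fun v => ⟨⟨g v, fun x y => ?_⟩, fun c x => ?_⟩, fun a x => ?_⟩, ?_⟩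
  · exact key v (g v x + g v y, x + y) (Submodule.add_mem _ (hg v x) (hg v y))
  · exact key v (c • g v x, c • x) (Submodule.smul_mem _ c (hg v x))
  · exact key _ (A.map a (g _ x), X.map a x) (L.stable a _ (hg _ x))
  · apply SubRep.ext'
    funext v
    ext p
    refine (mem_graph _ v p).trans ?_
    constructor
    · intro hp
      have := hg v (Prod.snd p)
      change g v (Prod.snd p) = Prod.fst p at hp
      rw [hp] at this
      exact this
    · exact key v p

lemma FW_dsum [Fintype k] (A X : QRep Q k) (hA : IsSimple A) :
    FW (dsum A X) = -((homCard X A : ℚ) * FW X) := by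
  have := Fintype.ofFinite (SubRep (dsum A X))
  have hinl : (inlHom A X).Inj := fun v => LinearMap.inl_injective
  have hgr : ∀ h : Hom X A, (graphHom h).Inj := fun h v x y hxy => congrArg Prod.snd hxy
  rw [FW_eq_muN, muN_top_atom _ ((image_top_atom _ hinl).2 (simple_iff.1 hA))]
  have hb : Function.Bijective (fun h : Hom X A =>
      (⟨SubRep.image (graphHom h) ⊤, graph_compl h⟩ :
        {x // IsCompl x (SubRep.image (inlHom A X) ⊤)})) := by
    constructor
    · intro h h' hh
      have h1 := congrArg Subtype.val hh
      apply Hom.ext'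
      funext v
      ext x
      have h2 : ((h.app v x, x) : A.space v × X.space v) ∈
          (SubRep.image (graphHom h') ⊤).sub v := by
        have h3 : ((h.app v x, x) : A.space v × X.space v) ∈
          (SubRep.image (graphHom h) ⊤).sub v := (mem_graph h v _).2 rfl
        have h4 : SubRep.image (graphHom h) ⊤ = SubRep.image (graphHom h') ⊤ := h1
        rwa [h4] at h3
      exact ((mem_graph h' v _).1 h2).symm
    · rintro ⟨L, hL⟩
      obtain ⟨h, rfl⟩ := exists_graph L hL
      exact ⟨h, rfl⟩
  have hs : ∀ x : {x // IsCompl x (SubRep.image (inlHom A X) ⊤)}, muN x.1 = FW X := by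
    intro x
    obtain ⟨h, rfl⟩ := hb.2 x
    exact (FW_eq_of_inj (graphHom h) (hgr h)).symm
  rw [Finset.sum_congr rfl (fun x _ => hs x), Finset.sum_const, Finset.card_univ,
    ← Nat.card_eq_fintype_card, ← Nat.card_eq_of_bijective _ hb, nsmul_eq_mul]
  rfl

/-- Schur: no nonzero morphisms between non-isomorphic simples. -/
lemma schur {S T : QRep Q k} (hS : IsSimple S) (hT : IsSimple T)
    (h : ¬ IsIsomorphic S T) : homCard S T = 1 := by
  have hz : ∀ f : Hom S T, ∀ v x, f.app v x = 0 := by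
    intro f
    rcases hS.2 (SubRep.preim f ⊥) with h1 | h1
    · rcases hT.2 (SubRep.image f ⊤) with h2 | h2
      · intro v x
        have : f.app v x ∈ (SubRep.image f ⊤).sub v := ⟨x, trivial, rfl⟩
        rw [h2 v] at this
        exact this
      · exfalso
        apply h
        have hbij : ∀ v, Function.Bijective (f.app v) := by
          intro v
          constructor
          · rw [← LinearMap.ker_eq_bot]
            exact h1 v
          · intro y
            have : y ∈ (SubRep.image f ⊤).sub v := by rw [h2 v]; trivial
            obtain ⟨x, -, hx⟩ := this
            exact ⟨x, hx⟩
        exact ⟨⟨fun v => LinearEquiv.ofBijective (f.app v) (hbij v), fun a x => f.comm a x⟩⟩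
    · intro v x
      have : x ∈ (SubRep.preim f ⊥).sub v := by rw [h1 v]; trivial
      exact this
  unfold homCard
  rw [Nat.card_eq_one_iff_unique]
  refine ⟨⟨fun f g => Hom.ext' ?_⟩, ⟨⟨fun v => 0, fun a x => by simp⟩⟩⟩
  funext v
  ext x
  rw [hz, hz]

lemma lin_aux₁ {n : ℕ} (M : Fin n → Type) [∀ i, AddCommGroup (M i)] [∀ i, Module k (M i)]
    {N : Type} [AddCommGroup N] [Module k N] (F : (∀ i, M i) →ₗ[k] N) :
    ∑ j, (F.comp (LinearMap.single k M j)).comp (LinearMap.proj j) = F := by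
  refine LinearMap.pi_ext' fun j => ?_
  ext x
  simp only [LinearMap.comp_apply, LinearMap.sum_apply]
  rw [Finset.sum_eq_single j]
  · simp
  · intro i _ hij
    simp [hij]
  · simp

lemma lin_aux₂ {n : ℕ} (M : Fin n → Type) [∀ i, AddCommGroup (M i)] [∀ i, Module k (M i)]
    {N : Type} [AddCommGroup N] [Module k N] (G : ∀ i, M i →ₗ[k] N) (j : Fin n) :
    (∑ i, (G i).comp (LinearMap.proj i)).comp (LinearMap.single k M j) = G j := by
  ext x
  simp only [LinearMap.comp_apply, LinearMap.sum_apply]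
  rw [Finset.sum_eq_single j]
  · simp
  · intro i _ hij
    simp [hij]
  · simp

lemma homCard_dsumFin {n : ℕ} (Y : Fin n → QRep Q k) (A : QRep Q k) :
    homCard (dsumFin Y) A = ∏ j, homCard (Y j) A := by
  unfold homCard
  rw [← Nat.card_pi]
  refine Nat.card_congr ⟨fun f j => ⟨fun v => (f.app v).comp
      (LinearMap.single k (fun j => (Y j).space v) j), fun a x => ?_⟩,
    fun g => ⟨fun v => ∑ j, ((g j).app v).comp (LinearMap.proj j), fun a x => ?_⟩, ?_, ?_⟩
  · have hs : (Pi.single j ((Y j).map a x) : ∀ i, (Y i).space (Q.tgt a))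
        = fun i => (Y i).map a ((Pi.single j x : ∀ i, (Y i).space (Q.src a)) i) := by
      funext i
      rcases eq_or_ne i j with rfl | hij
      · simp
      · simp [hij]
    exact (congrArg (f.app (Q.tgt a)) hs).trans (f.comm a _)
  · simp only [LinearMap.sum_apply, LinearMap.comp_apply, map_sum]
    refine Finset.sum_congr rfl fun j _ => ?_
    exact (g j).comm a (x j)
  · intro f
    apply Hom.ext'
    funext v
    exact lin_aux₁ (fun j => (Y j).space v) (f.app v)
  · intro g
    funext j
    apply Hom.ext'
    funext v
    exact lin_aux₂ (fun j => (Y j).space v) (fun j => (g j).app v) j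

/-- Reindexing of direct sums. -/
def dsumReindex {ι κ : Type} [Fintype ι] [Fintype κ] (e : κ ≃ ι) (f : ι → QRep Q k) :
    Iso (dsumFin f) (dsumFin (fun j => f (e j))) :=
  ⟨fun v => (LinearEquiv.piCongrLeft k (fun i => (f i).space v) e).symm, fun _ _ => rfl⟩

/-- Splitting off the first summand. -/
def dsumSucc {n : ℕ} (f : Fin (n + 1) → QRep Q k) :
    Iso (dsumFin f) (dsum (f 0) (dsumFin (fun j : Fin n => f j.succ))) :=
  ⟨fun v => (Fin.consLinearEquiv k (fun i => (f i).space v)).symm, fun _ _ => rfl⟩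

lemma FW_zero [Fintype k] (W : QRep Q k) (h : (⊤ : SubRep W) = ⊥) : FW W = 1 := by
  rw [FW_eq_muN, h, muN_bot]

lemma FW_semisimple [Fintype k] {r : ℕ} (S : Fin r → QRep Q k) (hS : ∀ i, IsSimple (S i))
    (hne : ∀ i j, i ≠ j → ¬ IsIsomorphic (S i) (S j)) (n : ℕ) (c : Fin n → Fin r) :
    FW (dsumFin (fun j => S (c j))) = ∏ i : Fin r,
      (-1 : ℚ) ^ (∑ j, if c j = i then 1 else 0) *
        (homCard (S i) (S i) : ℚ) ^ ((∑ j, if c j = i then 1 else 0).choose 2) := by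
  induction n with
  | zero =>
    rw [FW_zero]
    · simp
    · apply SubRep.ext'
      funext v
      have : Subsingleton ((dsumFin fun j => S (c j)).space v) :=
        inferInstanceAs (Subsingleton (∀ j : Fin 0, (S (c j)).space v))
      exact Subsingleton.elim _ _
  | succ n ih =>
    rw [FW_iso ⟨dsumSucc (fun j => S (c j))⟩, FW_dsum _ _ (hS _), ih, homCard_dsumFin]
    have h1 : ∀ j, homCard (S (c (Fin.succ j))) (S (c 0))
        = homCard (S (c 0)) (S (c 0)) ^ (if c (Fin.succ j) = c 0 then 1 else 0) := by
      intro j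
      split_ifs with h
      · rw [h, pow_one]
      · rw [pow_zero, schur (hS _) (hS _) (hne _ _ h)]
    rw [Finset.prod_congr rfl (fun j _ => h1 j), Finset.prod_pow_eq_pow_sum]
    have h2 : ∀ i : Fin r, ((-1 : ℚ) ^ (∑ j, if c j = i then 1 else 0) *
        (homCard (S i) (S i) : ℚ) ^ ((∑ j, if c j = i then 1 else 0).choose 2))
        = (if c 0 = i then
            -((homCard (S i) (S i) : ℚ) ^ (∑ j, if c (Fin.succ j) = i then 1 else 0)) else 1) *
          ((-1 : ℚ) ^ (∑ j, if c (Fin.succ j) = i then 1 else 0) *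
        (homCard (S i) (S i) : ℚ) ^
          ((∑ j, if c (Fin.succ j) = i then 1 else 0).choose 2)) := by
      intro i
      rw [Fin.sum_univ_succ]
      generalize (∑ j : Fin n, if c (Fin.succ j) = i then 1 else 0) = N
      split_ifs with h
      · rw [add_comm 1 N, Nat.choose_succ_succ' N 1, Nat.choose_one_right, pow_succ, pow_add]
        ring
      · simp
    have h4 : ∀ (u w : Fin r → ℚ) (i0 : Fin r),
        ∏ i, (if i0 = i then u i else 1) * w i = u i0 * ∏ i, w i := by
      intro u w i0
      rw [Finset.prod_mul_distrib, Finset.prod_ite_eq]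
      simp
    rw [Finset.prod_congr rfl (fun i _ => h2 i)]
    refine Eq.trans ?_ (h4 _ _ _).symm
    push_cast
    ring

/-- The inclusion of a subrepresentation. -/
def inclHom {M : QRep Q k} (L : SubRep M) : Hom L.toRep M :=
  ⟨fun v => (L.sub v).subtype, fun _ _ => rfl⟩

lemma inclHom_inj {M : QRep Q k} (L : SubRep M) : (inclHom L).Inj :=
  fun _ => Subtype.val_injective

lemma image_incl {M : QRep Q k} (L : SubRep M) : SubRep.image (inclHom L) ⊤ = L := by
  apply SubRep.ext'
  funext v
  change Submodule.map (L.sub v).subtype ⊤ = L.sub v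
  rw [Submodule.map_top, Submodule.range_subtype]

/-- Internal direct sums. -/
lemma iso_of_compl {M : QRep Q k} {L L' : SubRep M} (h : IsCompl L L') :
    Nonempty (Iso M (dsum L.toRep L'.toRep)) := by
  rw [compl_iff] at h
  refine ⟨Iso.symm' ⟨fun v => Submodule.prodEquivOfIsCompl _ _ (h v), fun a x => ?_⟩⟩
  exact (map_add (M.map a) (Subtype.val (Prod.fst x)) (Subtype.val (Prod.snd x))).symm

lemma FW_nonsemisimple [Fintype k] (d : ℕ) : ∀ W : QRep Q k,
    ∑ v, Module.finrank k (W.space v) = d →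
    (¬ ∃ (r : ℕ) (S : Fin r → QRep Q k),
        (∀ i, IsSimple (S i)) ∧ IsIsomorphic W (dsumFin S)) → FW W = 0 := by
  induction d using Nat.strong_induction_on with
  | _ d ih =>
  intro W hd hW
  have := Fintype.ofFinite (SubRep W)
  have htop : (⊤ : SubRep W) ≠ ⊥ := by
    intro h0
    apply hW
    refine ⟨0, fun i => i.elim0, fun i => i.elim0, ⟨⟨fun v => ?_, fun a x => ?_⟩⟩⟩
    · have : Subsingleton (W.space v) := by
        have h2 : (⊤ : Submodule k (W.space v)) = ⊥ := congrFun (congrArg SubRep.sub h0) v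
        exact (Submodule.subsingleton_iff k).1 (subsingleton_of_bot_eq_top h2.symm)
      have : Subsingleton ((dsumFin (fun i : Fin 0 => (i.elim0 : QRep Q k))).space v) :=
        inferInstanceAs (Subsingleton (∀ j : Fin 0, (j.elim0 : QRep Q k).space v))
      exact 0
    · funext i
      exact i.elim0
  obtain ⟨a, ha, -⟩ := (eq_bot_or_exists_atom_le (⊤ : SubRep W)).resolve_left htop
  have hsimple : IsSimple a.toRep := by
    rw [simple_iff, ← image_top_atom (inclHom a) (inclHom_inj a), image_incl]
    exact ha
  rw [FW_eq_muN, muN_top_atom a ha, Finset.sum_eq_zero, neg_zero]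
  rintro ⟨x, hx⟩ -
  change muN x = 0
  have h1 := FW_eq_of_inj (inclHom x) (inclHom_inj x)
  rw [image_incl] at h1
  rw [← h1]
  refine ih (∑ v, Module.finrank k (x.toRep.space v)) ?_ x.toRep rfl ?_
  · rw [← hd]
    obtain ⟨e⟩ := iso_of_compl hx.symm
    have hdim : ∀ v, Module.finrank k (W.space v)
        = Module.finrank k (a.toRep.space v) + Module.finrank k (x.toRep.space v) := by
      intro v
      rw [(e.app v).finrank_eq]
      exact Module.finrank_prod
    obtain ⟨v, hv⟩ := Function.ne_iff.1 hsimple.1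
    apply Finset.sum_lt_sum
    · intro v _
      rw [hdim]
      omega
    · refine ⟨v, Finset.mem_univ _, ?_⟩
      rw [hdim]
      have : Module.finrank k (a.toRep.space v) ≠ 0 := hv
      omega
  · rintro ⟨r, S, hS, ⟨e⟩⟩
    apply hW
    refine ⟨r + 1, Fin.cons (α := fun _ => QRep Q k) a.toRep S, ?_, ?_⟩
    · intro i
      refine Fin.cases ?_ (fun i => ?_) i
      · exact hsimple
      · exact hS i
    · obtain ⟨e'⟩ := iso_of_compl hx.symm
      have e2 : Iso (dsum a.toRep x.toRep) (dsum a.toRep (dsumFin S)) :=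
        ⟨fun v => LinearEquiv.prodCongr (LinearEquiv.refl k _) (e.app v), fun b y =>
          Prod.ext rfl (e.comm b y.2)⟩
      exact ⟨(e'.trans' e2).trans' (Iso.symm'
        (dsumSucc (Fin.cons (α := fun _ => QRep Q k) a.toRep S)))⟩

end QRep

/-- `F_W = ∑_i (-1)^i F_i(W)` equals
`∏_{[S]} (-1)^{m_S} q_S^{m_S(m_S-1)/2}` when `W ≅ ⊕_{[S]} S^{m_S}` is
semisimple (product over pairwise non-isomorphic simples), and `F_W = 0`
when `W` is not semisimple. -/
theorem statement16 (Q : FinQuiver) (k : Type) [Field k] [Fintype k]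
    (W : QRep Q k) :
    (∀ (r : ℕ) (S : Fin r → QRep Q k) (m : Fin r → ℕ),
      (∀ i, IsSimple (S i)) → (∀ i, 0 < m i) →
      (∀ i j, i ≠ j → ¬ IsIsomorphic (S i) (S j)) →
      IsIsomorphic W (dsumFin (fun p : Σ i : Fin r, Fin (m i) => S p.1)) →
      FW W = ∏ i : Fin r,
        (-1 : ℚ) ^ (m i) * (homCard (S i) (S i) : ℚ) ^ ((m i).choose 2)) ∧
    ((¬ ∃ (r : ℕ) (S : Fin r → QRep Q k),
        (∀ i, IsSimple (S i)) ∧ IsIsomorphic W (dsumFin S)) →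
      FW W = 0) := by
  refine ⟨fun r S m hS _ hne hW => ?_, fun h => FW_nonsemisimple _ W rfl h⟩
  rw [FW_iso hW]
  have e := (Fintype.equivFin (Σ i : Fin r, Fin (m i))).symm
  rw [FW_iso ⟨dsumReindex e _⟩, FW_semisimple S hS hne _ (fun j => (e j).1)]
  refine Finset.prod_congr rfl fun i _ => ?_
  have h : (∑ j, if (e j).1 = i then 1 else 0) = m i := by
    rw [Equiv.sum_comp e (fun p : Σ i : Fin r, Fin (m i) => if p.1 = i then 1 else 0),
      Fintype.sum_sigma]
    rw [Finset.sum_eq_single i]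
    · simp
    · intro b _ hb
      simp [hb]
    · simp
  rw [h]

end HallPaper
end

section
/- Fix a slope function mu and a rational value mu_0. Let chi_{mu_0}^{ss} be the element of the completed Hall algebra H(Q) given by the sum of [W] over all isomorphism classes of mu-semistable representations W with mu(dim W) = mu_0, including W = 0. Then chi_{mu_0}^{ss} is invertible in H(Q) and (chi_{mu_0}^{ss})^{-1} = Sum_{[W]} F_W^{mu} [W], where the sum is over the same set of isomorphism classes and F_W^{mu} = Sum_{i>=0} (-1)^i times the number of chains 0 = W_0 < W_1 < ... < W_i = W of subrepresentations with all inclusions strict such that every subquotient W_j / W_{j-1} is mu-semistable of slope mu_0. -/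
/- Common setup: finite quivers, finite-dimensional representations over a
finite field, subrepresentations, quotients, Hall numbers, quiver
Grassmannians and flags, extensions, and the (completed) Hall algebra,
following J. Fei, "Counting using Hall algebras I. Quivers". -/

open scoped BigOperators

attribute [local instance] Classical.propDecidable

namespace HallPaper

open QRep

/-- The number of strict chains `0 = W_0 < ⋯ < W_i = W` all of whose
subquotients are `μ`-semistable of slope `μ₀`. -/
noncomputable def chainCountMu {Q : FinQuiver} {k : Type} [Field k]
    (σ θ : Q.V → ℤ) (μ₀ : ℚ) (M : QRep Q k) (i : ℕ) : ℕ :=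
  Nat.card {L : Fin (i + 1) → SubRep M //
    (L 0).IsZero ∧ (L (Fin.last i)).IsFull ∧
    ∀ j : Fin i, ∃ h : (L j.castSucc).le (L j.succ),
      (L j.castSucc).sub ≠ (L j.succ).sub ∧
      IsSemistable σ θ (SubRep.subquot (L j.castSucc) (L j.succ) h) ∧
      slope σ θ (SubRep.subquot (L j.castSucc) (L j.succ) h).dimVec = μ₀}

/-- `F_W^μ`, the alternating sum of the numbers of such chains. -/
noncomputable def FWmu {Q : FinQuiver} {k : Type} [Field k]
    (σ θ : Q.V → ℤ) (μ₀ : ℚ) (M : QRep Q k) : ℚ :=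
  ∑ᶠ i : ℕ, (-1 : ℚ) ^ i * (chainCountMu σ θ μ₀ M i : ℚ)

/-- `χ_{μ₀}^{ss}`: the sum of all `[W]` with `W` `μ`-semistable of slope `μ₀`
(including `W = 0`). -/
noncomputable def chiSSmu (Q : FinQuiver) (k : Type) [Field k]
    (σ θ : Q.V → ℤ) (μ₀ : ℚ) : HallAlg Q k :=
  fun c =>
    if c.1 = 0 ∨ (IsSemistable σ θ c.rep ∧ slope σ θ c.1 = μ₀) then 1 else 0

/-- The claimed inverse `∑_{[W]} F_W^μ [W]`. -/
noncomputable def chiSSmuInv (Q : FinQuiver) (k : Type) [Field k]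
    (σ θ : Q.V → ℤ) (μ₀ : ℚ) : HallAlg Q k :=
  fun c =>
    if c.1 = 0 ∨ (IsSemistable σ θ c.rep ∧ slope σ θ c.1 = μ₀) then
      FWmu σ θ μ₀ c.rep
    else 0


namespace QRep

variable {Q : FinQuiver} {k : Type} [Field k]

namespace SubRep

theorem ext_sub {M : QRep Q k} {L L' : SubRep M} (h : ∀ v, L.sub v = L'.sub v) : L = L' := by
  cases L; cases L'
  congr
  funext v
  exact h v

instance instPartialOrder (M : QRep Q k) : PartialOrder (SubRep M) where
  le := SubRep.le
  le_refl := fun _ _ => le_rfl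
  le_trans := fun _ _ _ h h' v => (h v).trans (h' v)
  le_antisymm := fun _ _ h h' => ext_sub fun v => le_antisymm (h v) (h' v)

theorem le_iff {M : QRep Q k} {L L' : SubRep M} : L ≤ L' ↔ ∀ v, L.sub v ≤ L'.sub v := Iff.rfl

instance instBoundedOrder (M : QRep Q k) : BoundedOrder (SubRep M) where
  top := ⟨fun _ => ⊤, fun _ _ _ => trivial⟩
  bot := ⟨fun _ => ⊥, fun a x hx => by
    rw [Submodule.mem_bot] at hx ⊢
    rw [hx, map_zero]⟩
  le_top := fun _ _ => le_top
  bot_le := fun _ _ => bot_le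

@[simp] theorem top_sub (M : QRep Q k) (v : Q.V) : (⊤ : SubRep M).sub v = ⊤ := rfl
@[simp] theorem bot_sub (M : QRep Q k) (v : Q.V) : (⊥ : SubRep M).sub v = ⊥ := rfl

theorem isZero_iff_s18 {M : QRep Q k} {L : SubRep M} : L.IsZero ↔ L = ⊥ :=
  ⟨fun h => ext_sub h, fun h => by subst h; exact fun _ => rfl⟩

theorem isFull_iff_s18 {M : QRep Q k} {L : SubRep M} : L.IsFull ↔ L = ⊤ :=
  ⟨fun h => ext_sub h, fun h => by subst h; exact fun _ => rfl⟩

/-- Intersection of subrepresentations. -/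
def inter {M : QRep Q k} (L L' : SubRep M) : SubRep M :=
  ⟨fun v => L.sub v ⊓ L'.sub v, fun a x hx => ⟨L.stable a x hx.1, L'.stable a x hx.2⟩⟩

/-- Sum of subrepresentations. -/
def plus {M : QRep Q k} (L L' : SubRep M) : SubRep M :=
  ⟨fun v => L.sub v ⊔ L'.sub v, fun a x hx => by
    obtain ⟨y, hy, z, hz, rfl⟩ := Submodule.mem_sup.1 hx
    rw [map_add]
    exact Submodule.add_mem_sup (L.stable a y hy) (L'.stable a z hz)⟩

instance instFinite [Finite k] (M : QRep Q k) : Finite (SubRep M) := by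
  have : ∀ v, Finite (M.space v) := fun v => Module.finite_of_finite k
  have : ∀ v, Finite (Submodule k (M.space v)) := fun v =>
    Finite.of_injective (fun p : Submodule k (M.space v) => (p : Set (M.space v)))
      SetLike.coe_injective
  exact Finite.of_injective (fun L : SubRep M => L.sub)
    fun L L' h => ext_sub fun v => congrFun h v

noncomputable instance instFintype [Finite k] (M : QRep Q k) : Fintype (SubRep M) :=
  Fintype.ofFinite _

end SubRep

end QRep

/-- The linear functional `σ - μ₀ θ` on dimension vectors. -/
noncomputable def phi {Q : FinQuiver} (σ θ : Q.V → ℤ) (μ₀ : ℚ) (α : Q.V → ℕ) : ℚ :=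
  (wt σ α : ℚ) - μ₀ * (wt θ α : ℚ)

theorem phi_eq {Q : FinQuiver} (σ θ : Q.V → ℤ) (μ₀ : ℚ) (α : Q.V → ℕ) :
    phi σ θ μ₀ α = ∑ v, ((σ v : ℚ) - μ₀ * θ v) * (α v : ℚ) := by
  unfold phi wt
  push_cast
  rw [Finset.mul_sum, ← Finset.sum_sub_distrib]
  exact Finset.sum_congr rfl fun v _ => by ring

theorem phi_add {Q : FinQuiver} (σ θ : Q.V → ℤ) (μ₀ : ℚ) (α β : Q.V → ℕ) :
    phi σ θ μ₀ (α + β) = phi σ θ μ₀ α + phi σ θ μ₀ β := by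
  simp only [phi_eq, ← Finset.sum_add_distrib, Pi.add_apply]
  exact Finset.sum_congr rfl fun v _ => by push_cast; ring

theorem phi_zero {Q : FinQuiver} (σ θ : Q.V → ℤ) (μ₀ : ℚ) :
    phi σ θ μ₀ (0 : Q.V → ℕ) = 0 := by
  simp [phi_eq]

theorem slope_eq_iff {Q : FinQuiver} {σ θ : Q.V → ℤ} (hθ : SlopeOK θ) {μ₀ : ℚ} {α : Q.V → ℕ}
    (hα : α ≠ 0) : slope σ θ α = μ₀ ↔ phi σ θ μ₀ α = 0 := by
  have h : (0 : ℚ) < wt θ α := by exact_mod_cast hθ α hα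
  unfold slope phi
  rw [div_eq_iff h.ne', sub_eq_zero]

theorem slope_le_iff {Q : FinQuiver} {σ θ : Q.V → ℤ} (hθ : SlopeOK θ) {μ₀ : ℚ} {α : Q.V → ℕ}
    (hα : α ≠ 0) : slope σ θ α ≤ μ₀ ↔ phi σ θ μ₀ α ≤ 0 := by
  have h : (0 : ℚ) < wt θ α := by exact_mod_cast hθ α hα
  unfold slope phi
  rw [div_le_iff₀ h, sub_nonpos]

namespace QRep

variable {Q : FinQuiver} {k : Type} [Field k]

theorem dim_top (M : QRep Q k) : (⊤ : SubRep M).dim = M.dimVec := by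
  funext v
  exact finrank_top k (M.space v)

theorem dim_bot (M : QRep Q k) : (⊥ : SubRep M).dim = 0 := by
  funext v
  exact finrank_bot k (M.space v)

theorem dim_eq_zero_iff {M : QRep Q k} (L : SubRep M) : L.dim = 0 ↔ L = ⊥ := by
  refine ⟨fun h => SubRep.ext_sub fun v => ?_, fun h => by rw [h, dim_bot]⟩
  exact Submodule.finrank_eq_zero.1 (congrFun h v)

/-- `phi` on subrepresentations. -/
noncomputable def ph (σ θ : Q.V → ℤ) (μ₀ : ℚ) {M : QRep Q k} (L : SubRep M) : ℚ :=
  phi σ θ μ₀ L.dim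

theorem ph_mod (σ θ : Q.V → ℤ) (μ₀ : ℚ) {M : QRep Q k} (L L' : SubRep M) :
    ph σ θ μ₀ (L.plus L') + ph σ θ μ₀ (L.inter L') = ph σ θ μ₀ L + ph σ θ μ₀ L' := by
  unfold ph
  rw [← phi_add, ← phi_add]
  congr 1
  funext v
  exact Submodule.finrank_sup_add_finrank_inf_eq (L.sub v) (L'.sub v)

/-- The interval `[A, B]` has subquotient in the category of semistables of slope `μ₀`
(or zero). -/
def PP (σ θ : Q.V → ℤ) (μ₀ : ℚ) {M : QRep Q k} (A B : SubRep M) : Prop :=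
  A ≤ B ∧ ph σ θ μ₀ B = ph σ θ μ₀ A ∧
    ∀ C : SubRep M, A ≤ C → C ≤ B → ph σ θ μ₀ C ≤ ph σ θ μ₀ A

theorem PP.refl (σ θ : Q.V → ℤ) (μ₀ : ℚ) {M : QRep Q k} (A : SubRep M) : PP σ θ μ₀ A A :=
  ⟨le_rfl, rfl, fun C h h' => by rw [le_antisymm h h']⟩

theorem PP.trans {σ θ : Q.V → ℤ} {μ₀ : ℚ} {M : QRep Q k} {A B C : SubRep M}
    (h : PP σ θ μ₀ A B) (h' : PP σ θ μ₀ B C) : PP σ θ μ₀ A C := by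
  refine ⟨h.1.trans h'.1, h'.2.1.trans h.2.1, fun N hA hC => ?_⟩
  have h1 := h.2.2 (N.inter B) (fun v => le_inf (hA v) (h.1 v)) (fun v => inf_le_right)
  have h2 := h'.2.2 (N.plus B) (fun v => le_sup_right) (fun v => sup_le (hC v) (h'.1 v))
  have h3 := ph_mod σ θ μ₀ N B
  linarith

/-- The condition defining the category. -/
def InC (σ θ : Q.V → ℤ) (μ₀ : ℚ) (M : QRep Q k) : Prop :=
  M.dimVec = 0 ∨ (IsSemistable σ θ M ∧ slope σ θ M.dimVec = μ₀)

theorem inC_iff {σ θ : Q.V → ℤ} (hθ : SlopeOK θ) {μ₀ : ℚ} (M : QRep Q k) :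
    InC σ θ μ₀ M ↔ PP σ θ μ₀ (⊥ : SubRep M) ⊤ := by
  have hb : ph σ θ μ₀ (⊥ : SubRep M) = 0 := by unfold ph; rw [dim_bot, phi_zero]
  have ht : ph σ θ μ₀ (⊤ : SubRep M) = phi σ θ μ₀ M.dimVec := by unfold ph; rw [dim_top]
  by_cases h0 : M.dimVec = 0
  · have : (⊤ : SubRep M) = ⊥ := by rw [← dim_eq_zero_iff, dim_top, h0]
    rw [this]
    exact ⟨fun _ => PP.refl _ _ _ _, fun _ => Or.inl h0⟩
  · constructor
    · rintro (h | ⟨h, h'⟩)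
      · exact absurd h h0
      · have e := (slope_eq_iff hθ h0).1 h'
        refine ⟨bot_le, by rw [hb, ht, e], fun C _ _ => ?_⟩
        rw [hb]
        by_cases c0 : C = ⊥
        · rw [c0, hb]
        by_cases c1 : C = ⊤
        · rw [c1, ht, e]
        have := h C (fun z => c0 (SubRep.isZero_iff_s18.1 z)) (fun z => c1 (SubRep.isFull_iff_s18.1 z))
        rw [h'] at this
        exact (slope_le_iff hθ (fun z => c0 ((dim_eq_zero_iff C).1 z))).1 this
    · rintro ⟨-, h1, h2⟩
      rw [hb, ht] at h1
      have e := (slope_eq_iff hθ h0).2 h1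
      refine Or.inr ⟨fun L l0 _ => ?_, e⟩
      rw [e, slope_le_iff hθ (fun z => l0 (SubRep.isZero_iff_s18.2 ((dim_eq_zero_iff L).1 z)))]
      have := h2 L bot_le le_top
      rwa [hb] at this

/-- `M` is identified with the subquotient `B / A` of `N`. -/
structure SQ (N : QRep Q k) (A B : SubRep N) (M : QRep Q k) where
  le : A ≤ B
  g : ∀ v, B.sub v →ₗ[k] M.space v
  surj : ∀ v, Function.Surjective (g v)
  ker : ∀ v (x : B.sub v), g v x = 0 ↔ (x : N.space v) ∈ A.sub v
  comm : ∀ (a : Q.A) (x : B.sub (Q.src a)),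
    g (Q.tgt a) ⟨N.map a x, B.stable a x x.2⟩ = M.map a (g (Q.src a) x)

namespace SQ

variable {N M : QRep Q k} {A B : SubRep N} (S : SQ N A B M)

/-- Preimage of a subrepresentation of the subquotient. -/
def e (K : SubRep M) : SubRep N where
  sub := fun v => ((K.sub v).comap (S.g v)).map (B.sub v).subtype
  stable := by
    rintro a x ⟨y, hy, rfl⟩
    refine ⟨⟨N.map a y, B.stable a y y.2⟩, ?_, rfl⟩
    have hy' : S.g _ y ∈ K.sub _ := hy
    show S.g _ _ ∈ K.sub _
    rw [S.comm]
    exact K.stable a _ hy'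

theorem mem_e (K : SubRep M) (v : Q.V) (x : N.space v) :
    x ∈ (S.e K).sub v ↔ ∃ h : x ∈ B.sub v, S.g v ⟨x, h⟩ ∈ K.sub v := by
  constructor
  · rintro ⟨y, hy, rfl⟩
    exact ⟨y.2, hy⟩
  · rintro ⟨h, h'⟩
    exact ⟨⟨x, h⟩, h', rfl⟩

theorem e_le_iff (K K' : SubRep M) : S.e K ≤ S.e K' ↔ K ≤ K' := by
  constructor
  · intro h v x hx
    obtain ⟨y, rfl⟩ := S.surj v x
    have := h v ((S.mem_e K v y).2 ⟨y.2, hx⟩)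
    exact ((S.mem_e K' v y).1 this).2
  · intro h v x hx
    obtain ⟨h1, h2⟩ := (S.mem_e K v x).1 hx
    exact (S.mem_e K' v x).2 ⟨h1, h v h2⟩

theorem e_inj : Function.Injective S.e := fun K K' h =>
  le_antisymm ((S.e_le_iff K K').1 h.le) ((S.e_le_iff K' K).1 h.ge)

theorem e_bot : S.e ⊥ = A := by
  apply SubRep.ext_sub
  intro v
  ext x
  rw [S.mem_e]
  constructor
  · rintro ⟨h, h'⟩
    exact (S.ker v ⟨x, h⟩).1 ((Submodule.mem_bot k).1 h')
  · intro h
    exact ⟨S.le v h, (Submodule.mem_bot k).2 ((S.ker v ⟨x, S.le v h⟩).2 h)⟩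

theorem e_top : S.e ⊤ = B := by
  apply SubRep.ext_sub
  intro v
  ext x
  rw [S.mem_e]
  exact ⟨fun h => h.1, fun h => ⟨h, trivial⟩⟩

theorem mem_range (C : SubRep N) (h : A ≤ C) (h' : C ≤ B) : ∃ K, S.e K = C := by
  refine ⟨⟨fun v => ((C.sub v).comap (B.sub v).subtype).map (S.g v), ?_⟩, ?_⟩
  · rintro a x ⟨y, hy, rfl⟩
    refine ⟨⟨N.map a y, B.stable a y y.2⟩, C.stable a _ hy, S.comm a y⟩
  · apply SubRep.ext_sub
    intro v
    ext x
    rw [S.mem_e]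
    constructor
    · rintro ⟨hx, y, hy, hxy⟩
      have hy' : (y : N.space v) ∈ C.sub v := hy
      have : S.g v (⟨x, hx⟩ - y) = 0 := by rw [map_sub, hxy, sub_self]
      have := h v ((S.ker v _).1 this)
      have := (C.sub v).add_mem this hy'
      simpa using this
    · intro hx
      exact ⟨h' v hx, ⟨x, h' v hx⟩, hx, rfl⟩

theorem dim_e (K : SubRep M) : (S.e K).dim = K.dim + A.dim := by
  funext v
  show Module.finrank k ((S.e K).sub v) = Module.finrank k (K.sub v) + Module.finrank k (A.sub v)
  let f : (S.e K).sub v →ₗ[k] K.sub v :=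
    { toFun := fun x => ⟨S.g v ⟨x, ((S.mem_e K v x).1 x.2).1⟩, ((S.mem_e K v x).1 x.2).2⟩
      map_add' := fun x y => Subtype.ext (map_add (S.g v) ⟨x, _⟩ ⟨y, _⟩)
      map_smul' := fun c x => Subtype.ext (map_smul (S.g v) c ⟨x, _⟩) }
  have hf : Function.Surjective f := by
    rintro ⟨x, hx⟩
    obtain ⟨y, rfl⟩ := S.surj v x
    exact ⟨⟨y, (S.mem_e K v y).2 ⟨y.2, hx⟩⟩, rfl⟩
  have hA : A.sub v ≤ (S.e K).sub v := by
    have := (S.e_le_iff ⊥ K).2 bot_le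
    rw [e_bot] at this
    exact this v
  have hk : LinearMap.ker f = (A.sub v).comap ((S.e K).sub v).subtype := by
    ext x
    rw [LinearMap.mem_ker, Submodule.mem_comap, ← Subtype.coe_inj]
    exact S.ker v ⟨x, _⟩
  have := LinearMap.finrank_range_add_finrank_ker f
  rw [LinearMap.range_eq_top.2 hf, finrank_top, hk,
    (Submodule.comapSubtypeEquivOfLe hA).finrank_eq] at this
  exact this.symm

theorem ph_e (σ θ : Q.V → ℤ) (μ₀ : ℚ) (K : SubRep M) :
    ph σ θ μ₀ (S.e K) = ph σ θ μ₀ K + ph σ θ μ₀ A := by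
  unfold ph
  rw [dim_e, phi_add]

theorem pp_e (σ θ : Q.V → ℤ) (μ₀ : ℚ) (K K' : SubRep M) :
    PP σ θ μ₀ (S.e K) (S.e K') ↔ PP σ θ μ₀ K K' := by
  unfold PP
  rw [e_le_iff, ph_e, ph_e, add_left_inj]
  refine and_congr_right fun _ => and_congr_right fun _ => ?_
  constructor
  · intro h C h1 h2
    have := h (S.e C) ((S.e_le_iff _ _).2 h1) ((S.e_le_iff _ _).2 h2)
    rw [ph_e] at this
    linarith
  · intro h C h1 h2
    obtain ⟨C, rfl⟩ := S.mem_range C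
      (by rw [← S.e_bot]; exact ((S.e_le_iff _ _).2 bot_le).trans h1)
      (by rw [← S.e_top]; exact h2.trans ((S.e_le_iff _ _).2 le_top))
    have := h C ((S.e_le_iff _ _).1 h1) ((S.e_le_iff _ _).1 h2)
    rw [ph_e]
    linarith

theorem inC_iff {σ θ : Q.V → ℤ} (hθ : SlopeOK θ) {μ₀ : ℚ} (S : SQ N A B M) :
    InC σ θ μ₀ M ↔ PP σ θ μ₀ A B := by
  rw [QRep.inC_iff hθ, ← S.pp_e, e_bot, e_top]

/-- The tautological subquotient. -/
def ofSubquot (A B : SubRep N) (h : A.le B) : SQ N A B (SubRep.subquot A B h) where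
  le := h
  g := fun v => Submodule.mkQ _
  surj := fun v => Submodule.mkQ_surjective _
  ker := fun v x => Submodule.Quotient.mk_eq_zero ((A.sub v).comap (B.sub v).subtype)
  comm := fun a x => rfl

/-- Subrepresentation as subquotient. -/
def ofSub (L : SubRep N) (i : Iso L.toRep M) : SQ N ⊥ L M where
  le := bot_le
  g := fun v => (i.app v).toLinearMap
  surj := fun v => (i.app v).surjective
  ker := fun v x => (LinearEquiv.map_eq_zero_iff (i.app v)).trans
    ((Submodule.coe_eq_zero (p := L.sub v)).symm.trans (Submodule.mem_bot k).symm)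
  comm := fun a x => i.comm a x

/-- Quotient representation as subquotient. -/
def ofQuot (L : SubRep N) (i : Iso L.quotRep M) : SQ N L ⊤ M where
  le := le_top
  g := fun v => ((i.app v).toLinearMap.comp (Submodule.mkQ (L.sub v))).comp
    (Submodule.subtype ⊤)
  surj := fun v => by
    intro y
    obtain ⟨x, rfl⟩ := (i.app v).surjective y
    obtain ⟨z, rfl⟩ := Submodule.mkQ_surjective (L.sub v) x
    exact ⟨⟨z, trivial⟩, rfl⟩
  ker := fun v x => (LinearEquiv.map_eq_zero_iff (i.app v)).trans
    (Submodule.Quotient.mk_eq_zero (L.sub v))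
  comm := fun a x => i.comm a (Submodule.Quotient.mk (x : N.space (Q.src a)))

end SQ

end QRep

theorem card_chain {X : Type*} [Fintype X] (r : X → X → Prop) (i : ℕ) (a b : X) :
    (Nat.card {L : Fin (i + 1) → X // L 0 = a ∧ L (Fin.last i) = b ∧
      ∀ j : Fin i, r (L j.castSucc) (L j.succ)} : ℚ) =
    ((Matrix.of fun a b => if r a b then (1 : ℚ) else 0) ^ i) a b := by
  have key : ∀ (i : ℕ) (a b : X), (∑ L : Fin (i + 1) → X, if L 0 = a ∧ L (Fin.last i) = b ∧
      ∀ j : Fin i, r (L j.castSucc) (L j.succ) then (1 : ℚ) else 0) =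
      ((Matrix.of fun a b => if r a b then (1 : ℚ) else 0) ^ i) a b := by
    intro i
    induction i with
    | zero =>
      intro a b
      rw [pow_zero, Matrix.one_apply, ← (Equiv.funUnique (Fin 1) X).symm.sum_comp]
      simp only [Equiv.funUnique_symm_apply, IsEmpty.forall_iff, and_true]
      rw [Finset.sum_eq_single a]
      · simp [uniqueElim_const]
      · intro c _ hc
        simp [uniqueElim_const, hc]
      · simp
    | succ i ih =>
      intro a b
      rw [pow_succ', Matrix.mul_apply]
      simp_rw [← ih]
      rw [← (Fin.consEquiv (fun _ : Fin (i + 2) => X)).sum_comp, Fintype.sum_prod_type,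
        Finset.sum_comm]
      simp_rw [Finset.mul_sum]
      rw [Finset.sum_comm (s := (Finset.univ : Finset X))]
      refine Finset.sum_congr rfl fun L _ => ?_
      rw [Finset.sum_eq_single a, Finset.sum_eq_single (L 0)]
      · have h1 : ∀ x : X, (∀ j : Fin (i + 1), r ((Fin.cons x L : Fin (i + 2) → X) j.castSucc)
            ((Fin.cons x L : Fin (i + 2) → X) j.succ)) ↔
            (r x (L 0) ∧ ∀ j : Fin i, r (L j.castSucc) (L j.succ)) := by
          intro x
          rw [Fin.forall_fin_succ]
          simp
        have h2 : (Fin.cons a L : Fin (i + 2) → X) (Fin.last (i + 1)) = L (Fin.last i) := by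
          rw [← Fin.succ_last, Fin.cons_succ]
        simp only [Fin.consEquiv, Equiv.coe_fn_mk, h1, h2, Matrix.of_apply, Fin.cons_zero,
          true_and, ← ite_and, mul_ite, mul_one, mul_zero]
        congr 1
        apply propext
        tauto
      · intro c _ hc
        rw [if_neg (fun h => hc h.1.symm), mul_zero]
      · simp
      · intro c _ hc
        rw [if_neg (fun h => hc ?_)]
        simpa [Fin.consEquiv] using h.1
      · simp
  rw [← key, Finset.sum_boole, Nat.card_eq_fintype_card, Fintype.card_subtype]

namespace QRep

variable {Q : FinQuiver} {k : Type} [Field k] [Fintype k]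

/-- The strict relation. -/
def rel (σ θ : Q.V → ℤ) (μ₀ : ℚ) {M : QRep Q k} (A B : SubRep M) : Prop :=
  A ≠ B ∧ PP σ θ μ₀ A B

/-- The matrix of strict relations. -/
noncomputable def RR (σ θ : Q.V → ℤ) (μ₀ : ℚ) (M : QRep Q k) :
    Matrix (SubRep M) (SubRep M) ℚ :=
  Matrix.of fun A B => if rel σ θ μ₀ A B then 1 else 0

theorem one_add_RR (σ θ : Q.V → ℤ) (μ₀ : ℚ) {M : QRep Q k} (A B : SubRep M) :
    (1 + RR σ θ μ₀ M) A B = if PP σ θ μ₀ A B then 1 else 0 := by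
  rw [Matrix.add_apply, Matrix.one_apply]
  unfold RR
  rw [Matrix.of_apply]
  by_cases h : A = B
  · subst h
    simp [PP.refl, rel]
  · simp [h, rel]

theorem RR_pow_ne (σ θ : Q.V → ℤ) (μ₀ : ℚ) {M : QRep Q k} (i : ℕ) :
    ∀ (A B : SubRep M), (RR σ θ μ₀ M ^ i) A B ≠ 0 →
      PP σ θ μ₀ A B ∧ (Set.Iic A).ncard + i ≤ (Set.Iic B).ncard := by
  induction i with
  | zero =>
    intro A B h
    rw [pow_zero, Matrix.one_apply] at h
    have : A = B := by
      by_contra hne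
      rw [if_neg hne] at h
      exact h rfl
    subst this
    exact ⟨PP.refl _ _ _ _, le_rfl⟩
  | succ i ih =>
    intro A B h
    rw [pow_succ', Matrix.mul_apply] at h
    obtain ⟨C, -, hC⟩ := Finset.exists_ne_zero_of_sum_ne_zero h
    obtain ⟨h1, h2⟩ := ih C B (right_ne_zero_of_mul hC)
    have h3 := left_ne_zero_of_mul hC
    unfold RR at h3
    rw [Matrix.of_apply] at h3
    have h4 : rel σ θ μ₀ A C := by
      by_contra hne
      rw [if_neg hne] at h3
      exact h3 rfl
    refine ⟨h4.2.trans h1, ?_⟩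
    have : (Set.Iic A).ncard < (Set.Iic C).ncard :=
      Set.ncard_lt_ncard (Set.Iic_ssubset_Iic.2 (lt_of_le_of_ne h4.2.1 h4.1)) (Set.toFinite _)
    omega

theorem RR_pow_eq_zero (σ θ : Q.V → ℤ) (μ₀ : ℚ) (M : QRep Q k) (i : ℕ)
    (hi : Nat.card (SubRep M) < i) : RR σ θ μ₀ M ^ i = 0 := by
  ext A B
  by_contra h
  have := (RR_pow_ne σ θ μ₀ i A B h).2
  have h2 := Set.ncard_le_card (Set.Iic B)
  omega

/-- The alternating sum of powers, the inverse of `1 + RR`. -/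
noncomputable def GG (σ θ : Q.V → ℤ) (μ₀ : ℚ) (M : QRep Q k) :
    Matrix (SubRep M) (SubRep M) ℚ :=
  ∑ i ∈ Finset.range (Nat.card (SubRep M) + 1), (-RR σ θ μ₀ M) ^ i

theorem GG_mul (σ θ : Q.V → ℤ) (μ₀ : ℚ) (M : QRep Q k) :
    GG σ θ μ₀ M * (1 + RR σ θ μ₀ M) = 1 := by
  have h := geom_sum_mul (-RR σ θ μ₀ M) (Nat.card (SubRep M) + 1)
  rw [neg_pow, RR_pow_eq_zero _ _ _ _ _ (Nat.lt_succ_self _), mul_zero, zero_sub] at h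
  have e : (1 + RR σ θ μ₀ M) = -(-RR σ θ μ₀ M - 1) := by abel
  rw [e, mul_neg]
  exact neg_eq_iff_eq_neg.2 h

theorem mul_GG (σ θ : Q.V → ℤ) (μ₀ : ℚ) (M : QRep Q k) :
    (1 + RR σ θ μ₀ M) * GG σ θ μ₀ M = 1 := by
  have h := mul_geom_sum (-RR σ θ μ₀ M) (Nat.card (SubRep M) + 1)
  rw [neg_pow, RR_pow_eq_zero _ _ _ _ _ (Nat.lt_succ_self _), mul_zero, zero_sub] at h
  have e : (1 + RR σ θ μ₀ M) = -(-RR σ θ μ₀ M - 1) := by abel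
  rw [e, neg_mul]
  exact neg_eq_iff_eq_neg.2 h

theorem finsum_RR (σ θ : Q.V → ℤ) (μ₀ : ℚ) {M : QRep Q k} (A B : SubRep M) :
    ∑ᶠ i : ℕ, (-1 : ℚ) ^ i * (RR σ θ μ₀ M ^ i) A B = GG σ θ μ₀ M A B := by
  rw [finsum_eq_sum_of_support_subset (s := Finset.range (Nat.card (SubRep M) + 1))]
  · unfold GG
    rw [Matrix.sum_apply]
    refine Finset.sum_congr rfl fun i _ => ?_
    rcases Nat.even_or_odd i with h | h
    · rw [h.neg_one_pow, h.neg_pow, one_mul]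
    · rw [h.neg_one_pow, h.neg_pow, Matrix.neg_apply, neg_one_mul]
  · intro i hi
    rw [Finset.coe_range, Set.mem_Iio]
    by_contra hlt
    apply hi
    show (-1 : ℚ) ^ i * (RR σ θ μ₀ M ^ i) A B = 0
    rw [RR_pow_eq_zero _ _ _ _ _ (by omega), Matrix.zero_apply, mul_zero]

theorem GG_ne {σ θ : Q.V → ℤ} {μ₀ : ℚ} {M : QRep Q k} {A B : SubRep M}
    (h : GG σ θ μ₀ M A B ≠ 0) : PP σ θ μ₀ A B := by
  rw [← finsum_RR] at h
  obtain ⟨i, hi⟩ : ∃ i : ℕ, (-1 : ℚ) ^ i * (RR σ θ μ₀ M ^ i) A B ≠ 0 := by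
    by_contra hne
    push Not at hne
    exact h (by simp only [hne, finsum_zero])
  exact (RR_pow_ne σ θ μ₀ i A B (right_ne_zero_of_mul hi)).1

theorem SQ.RR_pow {N M : QRep Q k} {A B : SubRep N} (S : SQ N A B M) (σ θ : Q.V → ℤ) (μ₀ : ℚ)
    (i : ℕ) : ∀ K K' : SubRep M,
      (RR σ θ μ₀ M ^ i) K K' = (RR σ θ μ₀ N ^ i) (S.e K) (S.e K') := by
  induction i with
  | zero =>
    intro K K'
    simp only [pow_zero, Matrix.one_apply, S.e_inj.eq_iff]
  | succ i ih =>
    intro K K'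
    rw [pow_succ', pow_succ', Matrix.mul_apply, Matrix.mul_apply]
    refine Fintype.sum_of_injective S.e S.e_inj _ _ ?_ ?_
    · intro C hC
      by_contra hne
      apply hC
      have h1 := (RR_pow_ne σ θ μ₀ i _ _ (right_ne_zero_of_mul hne)).1.1
      have h2 := left_ne_zero_of_mul hne
      rw [← pow_one (RR σ θ μ₀ N)] at h2
      have h3 := (RR_pow_ne σ θ μ₀ 1 _ _ h2).1.1
      exact S.mem_range C
        (by rw [← S.e_bot]; exact ((S.e_le_iff _ _).2 bot_le).trans h3)
        (by rw [← S.e_top]; exact h1.trans ((S.e_le_iff _ _).2 le_top))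
    · intro C
      rw [ih]
      congr 1
      have hr : rel σ θ μ₀ (S.e K) (S.e C) ↔ rel σ θ μ₀ K C := by
        unfold rel
        rw [S.pp_e, S.e_inj.ne_iff]
      unfold RR
      rw [Matrix.of_apply, Matrix.of_apply]
      simp only [hr]

theorem chainCountMu_eq {σ θ : Q.V → ℤ} (hθ : SlopeOK θ) (μ₀ : ℚ) (M : QRep Q k) (i : ℕ) :
    (chainCountMu σ θ μ₀ M i : ℚ) = (RR σ θ μ₀ M ^ i) ⊥ ⊤ := by
  refine Eq.trans ?_ (card_chain (fun A B : SubRep M => rel σ θ μ₀ A B) i ⊥ ⊤)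
  unfold chainCountMu
  congr 1
  refine Nat.card_congr (Equiv.subtypeEquivRight fun L => ?_)
  rw [SubRep.isZero_iff_s18, SubRep.isFull_iff_s18]
  refine and_congr_right fun _ => and_congr_right fun _ => forall_congr' fun j => ?_
  generalize L j.castSucc = A
  generalize L j.succ = B
  have hne : A.sub ≠ B.sub ↔ A ≠ B :=
    not_congr ⟨fun h => SubRep.ext_sub fun v => congrFun h v, fun h => by rw [h]⟩
  constructor
  · rintro ⟨h, h1, h2⟩
    exact ⟨hne.1 h1, ((SQ.ofSubquot A B h).inC_iff hθ).1 (Or.inr h2)⟩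
  · rintro ⟨h1, h2⟩
    refine ⟨h2.1, hne.2 h1, ?_⟩
    rcases ((SQ.ofSubquot A B h2.1).inC_iff hθ).2 h2 with h | h
    · exfalso
      apply h1
      rw [← (SQ.ofSubquot A B h2.1).e_bot]
      conv_rhs => rw [← (SQ.ofSubquot A B h2.1).e_top]
      congr 1
      symm
      rw [← dim_eq_zero_iff, dim_top, h]
    · exact h

theorem SQ.FWmu_eq {σ θ : Q.V → ℤ} (hθ : SlopeOK θ) (μ₀ : ℚ) {N M : QRep Q k} {A B : SubRep N}
    (S : SQ N A B M) : FWmu σ θ μ₀ M = GG σ θ μ₀ N A B := by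
  unfold FWmu
  rw [← finsum_RR]
  refine finsum_congr fun i => ?_
  rw [chainCountMu_eq hθ, S.RR_pow, S.e_bot, S.e_top]



end QRep

section Classes

variable {Q : FinQuiver} {k : Type} [Field k]

/-- Inverse isomorphism. -/
def QRep.Iso.symm'_s18 {M N : QRep Q k} (i : Iso M N) : Iso N M where
  app := fun v => (i.app v).symm
  comm := fun a x => by
    rw [LinearEquiv.symm_apply_eq, i.comm, LinearEquiv.apply_symm_apply]

/-- Composite isomorphism. -/
def QRep.Iso.trans'_s18 {M N P : QRep Q k} (i : Iso M N) (j : Iso N P) : Iso M P where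
  app := fun v => (i.app v).trans (j.app v)
  comm := fun a x => by
    simp only [LinearEquiv.trans_apply, i.comm, j.comm]

theorem isoRel_equivalence (α : Q.V → ℕ) : Equivalence (isoRel Q k α) where
  refl := fun _ => ⟨⟨fun _ => LinearEquiv.refl _ _, fun _ _ => rfl⟩⟩
  symm := fun ⟨i⟩ => ⟨i.symm'_s18⟩
  trans := fun ⟨i⟩ ⟨j⟩ => ⟨i.trans'_s18 j⟩

theorem rep_mk {α : Q.V → ℕ} (W : StdRep Q k α) :
    IsIsomorphic (TotalClass.rep (⟨α, Quot.mk _ W⟩ : TotalClass Q k)) W.toQRep := by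
  have h : Quot.mk (isoRel Q k α) (Quot.out (Quot.mk (isoRel Q k α) W)) = Quot.mk _ W :=
    Quot.out_eq _
  exact ((isoRel_equivalence α).eqvGen_iff).1 (Quot.eqvGen_exact h)

theorem dimVec_rep (c : TotalClass Q k) : c.rep.dimVec = c.1 := by
  funext v
  exact Module.finrank_fin_fun k

theorem exists_std (M : QRep Q k) : ∃ W : StdRep Q k M.dimVec, IsIsomorphic W.toQRep M := by
  let b : ∀ v, M.space v ≃ₗ[k] (Fin (M.dimVec v) → k) := fun v =>
    (Module.finBasis k (M.space v)).equivFun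
  refine ⟨fun a => LinearMap.toMatrix' ((b (Q.tgt a)).toLinearMap.comp
    ((M.map a).comp (b (Q.src a)).symm.toLinearMap)), ⟨⟨fun v => (b v).symm, fun a x => ?_⟩⟩⟩
  have : (Matrix.mulVecLin (LinearMap.toMatrix' ((b (Q.tgt a)).toLinearMap.comp
      ((M.map a).comp (b (Q.src a)).symm.toLinearMap)))) x =
      b (Q.tgt a) (M.map a ((b (Q.src a)).symm x)) := by
    rw [← Matrix.toLin'_apply', Matrix.toLin'_toMatrix']
    rfl
  exact (congrArg (b (Q.tgt a)).symm this).trans (LinearEquiv.symm_apply_apply _ _)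

/-- The class of a representation. -/
noncomputable def cls (M : QRep Q k) : TotalClass Q k :=
  ⟨M.dimVec, Quot.mk _ (exists_std M).choose⟩

theorem iso_cls (M : QRep Q k) : IsIsomorphic M (cls M).rep := by
  obtain ⟨i⟩ := rep_mk (exists_std M).choose
  obtain ⟨j⟩ := (exists_std M).choose_spec
  exact ⟨(i.trans'_s18 j).symm'_s18⟩

theorem rep_inj (c d : TotalClass Q k) (h : IsIsomorphic c.rep d.rep) : c = d := by
  obtain ⟨i⟩ := h
  have hd : c.1 = d.1 := by
    rw [← dimVec_rep c, ← dimVec_rep d]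
    funext v
    exact (i.app v).finrank_eq
  obtain ⟨α, c⟩ := c
  obtain ⟨β, d⟩ := d
  obtain rfl : α = β := hd
  congr 1
  rw [← Quot.out_eq c, ← Quot.out_eq d]
  exact Quot.sound ⟨i⟩

theorem iso_iff_cls (M : QRep Q k) (c : TotalClass Q k) :
    IsIsomorphic M c.rep ↔ cls M = c := by
  constructor
  · rintro ⟨i⟩
    obtain ⟨j⟩ := iso_cls M
    exact rep_inj _ _ ⟨j.symm'_s18.trans'_s18 i⟩
  · rintro rfl
    exact iso_cls M

theorem hallMul_eq [Fintype k] (x y : HallAlg Q k) (W : TotalClass Q k) :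
    hallMul Q k x y W = ∑ L : SubRep W.rep, x (cls L.quotRep) * y (cls L.toRep) := by
  have hn : ∀ U V : TotalClass Q k, (hallNum U.rep V.rep W.rep : ℚ) =
      ∑ L : SubRep W.rep, if cls L.toRep = V ∧ cls L.quotRep = U then 1 else 0 := by
    intro U V
    unfold hallNum
    simp only [iso_iff_cls]
    rw [Finset.sum_boole, Nat.card_eq_fintype_card, Fintype.card_subtype]
  have inner : ∀ U : TotalClass Q k, (∑ᶠ V : TotalClass Q k,
      x U * y V * (hallNum U.rep V.rep W.rep : ℚ)) =
      ∑ L : SubRep W.rep, if cls L.quotRep = U then x U * y (cls L.toRep) else 0 := by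
    intro U
    rw [finsum_eq_sum_of_support_subset
      (s := Finset.univ.image fun L : SubRep W.rep => cls L.toRep)]
    · simp_rw [hn, Finset.mul_sum]
      rw [Finset.sum_comm]
      refine Finset.sum_congr rfl fun L _ => ?_
      rw [Finset.sum_eq_single (cls L.toRep)]
      · simp
      · intro V _ hV
        rw [if_neg (fun h => hV h.1.symm), mul_zero]
      · intro h
        exact absurd (Finset.mem_image_of_mem _ (Finset.mem_univ L)) h
    · intro V hV
      have h := right_ne_zero_of_mul (Function.mem_support.1 hV)
      rw [hn] at h
      obtain ⟨L, -, hL⟩ := Finset.exists_ne_zero_of_sum_ne_zero h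
      have h' : cls L.toRep = V ∧ cls L.quotRep = U := by
        by_contra hne
        rw [if_neg hne] at hL
        exact hL rfl
      rw [← h'.1]
      exact Finset.mem_coe.2 (Finset.mem_image_of_mem (fun L : SubRep W.rep => cls L.toRep)
        (Finset.mem_univ L))
  unfold hallMul
  simp_rw [inner]
  rw [finsum_eq_sum_of_support_subset
    (s := Finset.univ.image fun L : SubRep W.rep => cls L.quotRep)]
  · rw [Finset.sum_comm]
    refine Finset.sum_congr rfl fun L _ => ?_
    rw [Finset.sum_eq_single (cls L.quotRep)]
    · simp
    · intro V _ hV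
      rw [if_neg (fun h => hV h.symm)]
    · intro h
      exact absurd (Finset.mem_image_of_mem _ (Finset.mem_univ L)) h
  · intro U hU
    obtain ⟨L, -, hL⟩ := Finset.exists_ne_zero_of_sum_ne_zero (Function.mem_support.1 hU)
    have h' : cls L.quotRep = U := by
      by_contra hne
      rw [if_neg hne] at hL
      exact hL rfl
    rw [← h']
    exact Finset.mem_coe.2 (Finset.mem_image_of_mem (fun L : SubRep W.rep => cls L.quotRep)
      (Finset.mem_univ L))

theorem chi_eq [Fintype k] {σ θ : Q.V → ℤ} (hθ : SlopeOK θ) (μ₀ : ℚ) {N : QRep Q k}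
    {A B : SubRep N} {c : TotalClass Q k} (S : SQ N A B c.rep) :
    chiSSmu Q k σ θ μ₀ c = (1 + RR σ θ μ₀ N) A B := by
  rw [one_add_RR]
  unfold chiSSmu
  have h := S.inC_iff hθ (μ₀ := μ₀) (σ := σ)
  unfold InC at h
  rw [dimVec_rep] at h
  simp only [h]

theorem chiInv_eq [Fintype k] {σ θ : Q.V → ℤ} (hθ : SlopeOK θ) (μ₀ : ℚ) {N : QRep Q k}
    {A B : SubRep N} {c : TotalClass Q k} (S : SQ N A B c.rep) :
    chiSSmuInv Q k σ θ μ₀ c = GG σ θ μ₀ N A B := by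
  unfold chiSSmuInv
  have h := S.inC_iff hθ (μ₀ := μ₀) (σ := σ)
  unfold InC at h
  rw [dimVec_rep] at h
  simp only [h]
  rw [S.FWmu_eq hθ]
  by_cases hp : PP σ θ μ₀ A B
  · rw [if_pos hp]
  · rw [if_neg hp]
    by_contra hne
    exact hp (GG_ne (Ne.symm hne))

theorem one_eq [Fintype k] (W : TotalClass Q k) :
    (1 : Matrix (SubRep W.rep) (SubRep W.rep) ℚ) ⊥ ⊤ = hallOne Q k W := by
  rw [Matrix.one_apply]
  unfold hallOne
  have : ((⊥ : SubRep W.rep) = ⊤) ↔ W.1 = 0 := by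
    rw [eq_comm, ← dim_eq_zero_iff, dim_top, dimVec_rep]
  simp only [this]

end Classes

/-- `χ_{μ₀}^{ss}` is invertible in the completed Hall algebra
`H(Q)`, with two-sided inverse `∑_{[W]} F_W^μ [W]`. -/
theorem statement18 (Q : FinQuiver) (k : Type) [Field k] [Fintype k]
    (σ θ : Q.V → ℤ) (hθ : SlopeOK θ) (μ₀ : ℚ) :
    hallMul Q k (chiSSmu Q k σ θ μ₀) (chiSSmuInv Q k σ θ μ₀) = hallOne Q k ∧
    hallMul Q k (chiSSmuInv Q k σ θ μ₀) (chiSSmu Q k σ θ μ₀) = hallOne Q k := by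
  constructor
  · funext W
    rw [hallMul_eq, ← one_eq, ← GG_mul σ θ μ₀, Matrix.mul_apply]
    refine Finset.sum_congr rfl fun L _ => ?_
    rw [chi_eq hθ μ₀ (SQ.ofQuot L (iso_cls L.quotRep).some),
      chiInv_eq hθ μ₀ (SQ.ofSub L (iso_cls L.toRep).some), mul_comm]
  · funext W
    rw [hallMul_eq, ← one_eq, ← mul_GG σ θ μ₀, Matrix.mul_apply]
    refine Finset.sum_congr rfl fun L _ => ?_
    rw [chiInv_eq hθ μ₀ (SQ.ofQuot L (iso_cls L.quotRep).some),
      chi_eq hθ μ₀ (SQ.ofSub L (iso_cls L.toRep).some), mul_comm]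

end HallPaper
end
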